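/- Let r>0 and let F(r) ⊂ ℝ³ be the union of the 24 closed triangles with vertex triples (A^a, B^b, D^{abc}), (A^a, C^c, D^{abc}), (B^b, C^c, D^{abc}) for all a,b,c∈{+1,-1}, where A^a=(a,0,0), B^b=(0,b,0), C^c=(0,0,c), D^{abc}=(ar/3,br/3,cr/3). Let μ be the 2-dimensional Hausdorff measure restricted to F(r). Let r₂ be the unique positive real root of χ₂(r) = 4r⁴+8r³+6r²-18r-81. A continuous function f:ℝ³→ℝ satisfies f(x) = (1/μ(F(r)))·∫_{F(r)} f(x+s·y) dμ(y) for all x∈ℝ³ and all s>0 if and only if: (when r=r₂) f coincides with the function of a polynomial p∈ℝ[x₁,x₂,x₃] satisfying e₂(∂)p = e₆(∂)p = e₄(∂)²p = 0; and (when r≠r₂) f coincides with the function of a polynomial p satisfying e₂(∂)p = e₄(∂)p = e₆(∂)p = 0. -/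

import Mathlib

open MvPolynomial MeasureTheory

noncomputable def dop (φ : MvPolynomial (Fin 3) ℝ) :
    MvPolynomial (Fin 3) ℝ →ₗ[ℝ] MvPolynomial (Fin 3) ℝ :=
  φ.support.sum fun s => φ.coeff s •
    (((pderiv (0 : Fin 3)).toLinearMap ^ s 0) *
     ((pderiv (1 : Fin 3)).toLinearMap ^ s 1) *
     ((pderiv (2 : Fin 3)).toLinearMap ^ s 2))

noncomputable def e2 : MvPolynomial (Fin 3) ℝ := X 0 ^ 2 + X 1 ^ 2 + X 2 ^ 2
noncomputable def e4 : MvPolynomial (Fin 3) ℝ :=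
  X 1 ^ 2 * X 2 ^ 2 + X 2 ^ 2 * X 0 ^ 2 + X 0 ^ 2 * X 1 ^ 2
noncomputable def e6 : MvPolynomial (Fin 3) ℝ := X 0 ^ 2 * X 1 ^ 2 * X 2 ^ 2

noncomputable abbrev E3 := EuclideanSpace ℝ (Fin 3)

noncomputable def toFn (x : E3) : Fin 3 → ℝ := (WithLp.equiv 2 (Fin 3 → ℝ)) x

noncomputable def pt (u : Fin 3 → ℝ) : E3 := (WithLp.equiv 2 (Fin 3 → ℝ)).symm u

/-- A sign `±1` attached to a boolean. -/
def sg (b : Bool) : ℝ := if b then 1 else -1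

/-- Vertices of the regular octahedron. -/
noncomputable def vA (a : Bool) : E3 := pt ![sg a, 0, 0]
noncomputable def vB (b : Bool) : E3 := pt ![0, sg b, 0]
noncomputable def vC (c : Bool) : E3 := pt ![0, 0, sg c]

/-- Apex vertices of the isohedral triakis octahedron with parameter `r`. -/
noncomputable def vD (r : ℝ) (a b c : Bool) : E3 :=
  pt ![sg a * r / 3, sg b * r / 3, sg c * r / 3]

/-- The 2-skeleton (union of the 24 triangular faces) of the isohedral triakis
octahedron with parameter `r`. -/
noncomputable def faceSet (r : ℝ) : Set E3 :=
  ⋃ (a : Bool) (b : Bool) (c : Bool),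
    convexHull ℝ {vA a, vB b, vD r a b c} ∪
    convexHull ℝ {vA a, vC c, vD r a b c} ∪
    convexHull ℝ {vB b, vC c, vD r a b c}

/-- The first elementary symmetric polynomial in three variables. -/
noncomputable def s1 : MvPolynomial (Fin 3) ℝ := X 0 + X 1 + X 2

/-- The second elementary symmetric polynomial in three variables. -/
noncomputable def s2 : MvPolynomial (Fin 3) ℝ := X 1 * X 2 + X 2 * X 0 + X 0 * X 1

/-- The third elementary symmetric polynomial in three variables. -/
noncomputable def s3 : MvPolynomial (Fin 3) ℝ := X 0 * X 1 * X 2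

theorem esymm_one_eq : esymm (Fin 3) ℝ 1 = s1 := by
  simp [s1, esymm_one, Fin.sum_univ_three]

theorem esymm_two_eq : esymm (Fin 3) ℝ 2 = s2 := by
  have : Finset.powersetCard 2 (Finset.univ : Finset (Fin 3)) = {{1, 2}, {2, 0}, {0, 1}} := by
    decide
  rw [esymm, this, Finset.sum_insert (by decide), Finset.sum_insert (by decide),
    Finset.sum_singleton, s2]
  simp
  ring

theorem esymm_three_eq : esymm (Fin 3) ℝ 3 = s3 := by
  have : Finset.powersetCard 3 (Finset.univ : Finset (Fin 3)) = {Finset.univ} := by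
    decide
  rw [esymm, this, Finset.sum_singleton, s3, Fin.prod_univ_three]

theorem isHomogeneous_s1 : s1.IsHomogeneous 1 :=
  ((isHomogeneous_X ℝ 0).add (isHomogeneous_X ℝ 1)).add (isHomogeneous_X ℝ 2)

theorem isHomogeneous_s2 : s2.IsHomogeneous 2 :=
  (((isHomogeneous_X ℝ 1).mul (isHomogeneous_X ℝ 2)).add
    ((isHomogeneous_X ℝ 2).mul (isHomogeneous_X ℝ 0))).add
    ((isHomogeneous_X ℝ 0).mul (isHomogeneous_X ℝ 1))

theorem isHomogeneous_s3 : s3.IsHomogeneous 3 :=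
  ((isHomogeneous_X ℝ 0).mul (isHomogeneous_X ℝ 1)).mul (isHomogeneous_X ℝ 2)

/-- The products of elementary symmetric polynomials that are homogeneous of degree `n`. -/
def symmMonomials (n : ℕ) : Set (MvPolynomial (Fin 3) ℝ) :=
  {p | ∃ a b c : ℕ, a + 2 * b + 3 * c = n ∧ p = s1 ^ a * s2 ^ b * s3 ^ c}

theorem mem_span_symmMonomials {P : MvPolynomial (Fin 3) ℝ} {n : ℕ}
    (hs : P.IsSymmetric) (hh : P.IsHomogeneous n) :
    P ∈ Submodule.span ℝ (symmMonomials n) := by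
  obtain ⟨Q, hQ⟩ := esymmAlgHom_surjective (σ := Fin 3) ℝ (n := 3) (by simp) ⟨P, hs⟩
  have hP : P = aeval (fun i : Fin 3 ↦ esymm (Fin 3) ℝ (i + 1)) Q := by
    rw [← esymmAlgHom_apply, hQ]
  rw [← homogeneousComponent_eq_self hh, hP, Q.as_sum, map_sum, map_sum]
  refine Submodule.sum_mem _ fun t _ => ?_
  have ht : aeval (fun i : Fin 3 ↦ esymm (Fin 3) ℝ (i + 1)) (monomial t (coeff t Q)) =
      coeff t Q • (s1 ^ t 0 * s2 ^ t 1 * s3 ^ t 2) := by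
    rw [aeval_monomial, Finsupp.prod_fintype _ _ (by simp), Fin.prod_univ_three]
    simp only [Fin.val_zero, Fin.val_one, Fin.val_two, zero_add, esymm_one_eq]
    rw [show 1 + 1 = 2 from rfl, show 2 + 1 = 3 from rfl, esymm_two_eq, esymm_three_eq,
      Algebra.smul_def]
  have hhom : (s1 ^ t 0 * s2 ^ t 1 * s3 ^ t 2).IsHomogeneous (t 0 + 2 * t 1 + 3 * t 2) := by
    have := ((isHomogeneous_s1.pow (t 0)).mul (isHomogeneous_s2.pow (t 1))).mul
      (isHomogeneous_s3.pow (t 2))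
    simpa using this
  rw [ht, map_smul, homogeneousComponent_of_mem hhom]
  refine Submodule.smul_mem _ _ ?_
  split_ifs with h
  · exact Submodule.subset_span ⟨_, _, _, h.symm, rfl⟩
  · exact Submodule.zero_mem _

section symm
variable {P : MvPolynomial (Fin 3) ℝ} {n : ℕ}

theorem symm_mem_span_s1_s2_s3 (hn : 1 ≤ n) (hs : P.IsSymmetric) (hh : P.IsHomogeneous n) :
    P ∈ Ideal.span {s1, s2, s3} := by
  refine (Submodule.span_le (p := (Ideal.span {s1, s2, s3}).restrictScalars ℝ)).2 ?_
    (mem_span_symmMonomials hs hh)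
  rintro _ ⟨a, b, c, h, rfl⟩
  simp only [Submodule.coe_restrictScalars, SetLike.mem_coe]
  rcases Nat.eq_zero_or_pos a with rfl | ha
  · rcases Nat.eq_zero_or_pos b with rfl | hb
    · exact Ideal.mul_mem_left _ _
        (Ideal.pow_mem_of_mem _ (Ideal.subset_span (by simp)) _ (by omega))
    · exact Ideal.mul_mem_right _ _ (Ideal.mul_mem_left _ _
        (Ideal.pow_mem_of_mem _ (Ideal.subset_span (by simp)) _ hb))
  · exact Ideal.mul_mem_right _ _ (Ideal.mul_mem_right _ _
      (Ideal.pow_mem_of_mem _ (Ideal.subset_span (by simp)) _ ha))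

theorem symm_mem_span_s1_s3_s2_sq (hn : 3 ≤ n) (hs : P.IsSymmetric) (hh : P.IsHomogeneous n) :
    P ∈ Ideal.span {s1, s3, s2 ^ 2} := by
  refine (Submodule.span_le (p := (Ideal.span {s1, s3, s2 ^ 2}).restrictScalars ℝ)).2 ?_
    (mem_span_symmMonomials hs hh)
  rintro _ ⟨a, b, c, h, rfl⟩
  simp only [Submodule.coe_restrictScalars, SetLike.mem_coe]
  rcases Nat.eq_zero_or_pos a with rfl | ha
  · rcases Nat.eq_zero_or_pos c with rfl | hc
    · obtain ⟨k, rfl⟩ : ∃ k, b = 2 + k := ⟨b - 2, by omega⟩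
      rw [pow_add]
      exact Ideal.mul_mem_right _ _ (Ideal.mul_mem_left _ _ (Ideal.mul_mem_right _ _
        (Ideal.subset_span (by simp))))
    · exact Ideal.mul_mem_left _ _ (Ideal.pow_mem_of_mem _ (Ideal.subset_span (by simp)) _ hc)
  · exact Ideal.mul_mem_right _ _ (Ideal.mul_mem_right _ _
      (Ideal.pow_mem_of_mem _ (Ideal.subset_span (by simp)) _ ha))

theorem exists_sub_mem_of_symmMonomials {I : Ideal (MvPolynomial (Fin 3) ℝ)}
    {q : MvPolynomial (Fin 3) ℝ} (h : ∀ p ∈ symmMonomials n, p ∈ I ∨ p = q)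
    (hs : P.IsSymmetric) (hh : P.IsHomogeneous n) : ∃ d : ℝ, P - C d * q ∈ I := by
  have : Submodule.span ℝ (symmMonomials n) ≤ I.restrictScalars ℝ ⊔ Submodule.span ℝ {q} := by
    refine Submodule.span_le.2 fun p hp => ?_
    rcases h p hp with hI | rfl
    · exact Submodule.mem_sup_left hI
    · exact Submodule.mem_sup_right (Submodule.mem_span_singleton_self _)
  obtain ⟨y, hy, z, hz, rfl⟩ := Submodule.mem_sup.1 (this (mem_span_symmMonomials hs hh))
  obtain ⟨d, rfl⟩ := Submodule.mem_span_singleton.1 hz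
  refine ⟨d, ?_⟩
  simpa [smul_eq_C_mul] using hy

theorem eval_eq_of_sub_mem {I : Ideal (MvPolynomial (Fin 3) ℝ)} {q : MvPolynomial (Fin 3) ℝ}
    {d : ℝ} {u : Fin 3 → ℝ} (hI : I ≤ RingHom.ker (eval u)) (h : P - C d * q ∈ I) :
    eval u P = d * eval u q := by
  have := hI h
  rw [RingHom.mem_ker, map_sub, map_mul, eval_C] at this
  linarith

theorem mem_of_symm {I J : Ideal (MvPolynomial (Fin 3) ℝ)} {q : MvPolynomial (Fin 3) ℝ}
    {u : Fin 3 → ℝ} (h : ∀ p ∈ symmMonomials n, p ∈ I ∨ p = q) (hIJ : I ≤ J)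
    (hI : I ≤ RingHom.ker (eval u)) (hP : P ∈ J)
    (hs : P.IsSymmetric) (hh : P.IsHomogeneous n) (h0 : eval u P ≠ 0) : q ∈ J := by
  obtain ⟨d, hd⟩ := exists_sub_mem_of_symmMonomials h hs hh
  rw [eval_eq_of_sub_mem hI hd] at h0
  have hu : IsUnit (C d : MvPolynomial (Fin 3) ℝ) :=
    (isUnit_iff_ne_zero.2 (left_ne_zero_of_mul h0)).map C
  refine (Ideal.unit_mul_mem_iff_mem J hu).1 ?_
  simpa using J.sub_mem hP (hIJ hd)

theorem symmMonomials_one {p : MvPolynomial (Fin 3) ℝ} (hp : p ∈ symmMonomials 1) :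
    p ∈ (⊥ : Ideal (MvPolynomial (Fin 3) ℝ)) ∨ p = s1 := by
  obtain ⟨a, b, c, h, rfl⟩ := hp
  obtain ⟨rfl, rfl, rfl⟩ : a = 1 ∧ b = 0 ∧ c = 0 := by omega
  simp

theorem symmMonomials_two {p : MvPolynomial (Fin 3) ℝ} (hp : p ∈ symmMonomials 2) :
    p ∈ Ideal.span {s1} ∨ p = s2 := by
  obtain ⟨a, b, c, h, rfl⟩ := hp
  rcases Nat.eq_zero_or_pos a with rfl | ha
  · obtain ⟨rfl, rfl⟩ : b = 1 ∧ c = 0 := by omega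
    simp
  · exact .inl (Ideal.mul_mem_right _ _ (Ideal.mul_mem_right _ _
      (Ideal.pow_mem_of_mem _ (Ideal.subset_span (by simp)) _ ha)))

theorem symmMonomials_three {p : MvPolynomial (Fin 3) ℝ} (hp : p ∈ symmMonomials 3) :
    p ∈ Ideal.span {s1} ∨ p = s3 := by
  obtain ⟨a, b, c, h, rfl⟩ := hp
  rcases Nat.eq_zero_or_pos a with rfl | ha
  · obtain ⟨rfl, rfl⟩ : b = 0 ∧ c = 1 := by omega
    simp
  · exact .inl (Ideal.mul_mem_right _ _ (Ideal.mul_mem_right _ _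
      (Ideal.pow_mem_of_mem _ (Ideal.subset_span (by simp)) _ ha)))

theorem symmMonomials_four {p : MvPolynomial (Fin 3) ℝ} (hp : p ∈ symmMonomials 4) :
    p ∈ Ideal.span {s1, s3} ∨ p = s2 ^ 2 := by
  obtain ⟨a, b, c, h, rfl⟩ := hp
  rcases Nat.eq_zero_or_pos a with rfl | ha
  · obtain ⟨rfl, rfl⟩ : b = 2 ∧ c = 0 := by omega
    simp
  · exact .inl (Ideal.mul_mem_right _ _ (Ideal.mul_mem_right _ _
      (Ideal.pow_mem_of_mem _ (Ideal.subset_span (by simp)) _ ha)))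

theorem span_s1_le_ker {u : Fin 3 → ℝ} (h : u 0 + u 1 + u 2 = 0) :
    Ideal.span {s1} ≤ RingHom.ker (eval u) := by
  rw [Ideal.span_le, Set.singleton_subset_iff]
  simpa [RingHom.mem_ker, s1] using h

end symm

section cubes

variable {I : Ideal (MvPolynomial (Fin 3) ℝ)}

theorem X_cube_eq (i : Fin 3) :
    (X i ^ 3 : MvPolynomial (Fin 3) ℝ) = s1 * X i ^ 2 - s2 * X i + s3 := by
  fin_cases i <;> simp [s1, s2, s3] <;> ring

theorem X_pow_three_mem (h1 : s1 ∈ I) (h2 : s2 ∈ I) (h3 : s3 ∈ I) (i : Fin 3) :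
    (X i ^ 3 : MvPolynomial (Fin 3) ℝ) ∈ I := by
  rw [X_cube_eq]
  exact I.add_mem (I.sub_mem (I.mul_mem_right _ h1) (I.mul_mem_right _ h2)) h3

theorem X_pow_five_mem (h1 : s1 ∈ I) (h2 : s2 ^ 2 ∈ I) (h3 : s3 ∈ I) (i : Fin 3) :
    (X i ^ 5 : MvPolynomial (Fin 3) ℝ) ∈ I := by
  have : (X i ^ 5 : MvPolynomial (Fin 3) ℝ) =
      s1 * (X i ^ 4 - s2 * X i ^ 2) + s3 * (X i ^ 2 - s2) + s2 ^ 2 * X i := by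
    linear_combination (X i ^ 2 - s2) * X_cube_eq i
  rw [this]
  exact I.add_mem (I.add_mem (I.mul_mem_right _ h1) (I.mul_mem_right _ h3)) (I.mul_mem_right _ h2)

end cubes

/-- Substitution of three commuting elements of a (possibly noncommutative) algebra in a
polynomial. -/
noncomputable def opHom {A : Type*} [Ring A] [Algebra ℝ A] (d : Fin 3 → A)
    (hd : ∀ i j, Commute (d i) (d j)) : MvPolynomial (Fin 3) ℝ →ₐ[ℝ] A :=
  AddMonoidAlgebra.lift ℝ A (Fin 3 →₀ ℕ)
    { toFun := fun m => d 0 ^ m.toAdd 0 * d 1 ^ m.toAdd 1 * d 2 ^ m.toAdd 2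
      map_one' := by simp
      map_mul' := fun a b => by
        simp only [toAdd_mul, Finsupp.add_apply, pow_add]
        have h1 : ∀ m n, Commute (d 1 ^ m) (d 0 ^ n) := fun m n => (hd 1 0).pow_pow m n
        have h2 : ∀ m n, Commute (d 2 ^ m) (d 0 ^ n) := fun m n => (hd 2 0).pow_pow m n
        have h3 : ∀ m n, Commute (d 2 ^ m) (d 1 ^ n) := fun m n => (hd 2 1).pow_pow m n
        simp only [mul_assoc]
        congr 1
        rw [(h2 _ _).left_comm, (h1 _ _).left_comm, (h3 _ _).left_comm] }

section opHom

variable {A : Type*} [Ring A] [Algebra ℝ A] (d : Fin 3 → A) (hd : ∀ i j, Commute (d i) (d j))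

theorem opHom_monomial (s : Fin 3 →₀ ℕ) (c : ℝ) :
    opHom d hd (monomial s c) = c • (d 0 ^ s 0 * d 1 ^ s 1 * d 2 ^ s 2) :=
  AddMonoidAlgebra.lift_single _ _ _

theorem opHom_eq_sum (φ : MvPolynomial (Fin 3) ℝ) :
    opHom d hd φ = φ.support.sum fun s =>
      φ.coeff s • (d 0 ^ s 0 * d 1 ^ s 1 * d 2 ^ s 2) := by
  conv_lhs => rw [φ.as_sum, map_sum]
  simp only [opHom_monomial]

theorem opHom_X (i : Fin 3) : opHom d hd (X i) = d i := by
  rw [X, opHom_monomial]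
  fin_cases i <;> simp

theorem opHom_C (c : ℝ) : opHom d hd (C c) = algebraMap ℝ A c :=
  AlgHom.commutes _ c

end opHom

theorem commute_pderiv (i j : Fin 3) :
    Commute ((pderiv i).toLinearMap : Module.End ℝ (MvPolynomial (Fin 3) ℝ))
      ((pderiv j).toLinearMap) := by
  rw [commute_iff_lie_eq]
  have : ⁅(pderiv i : Derivation ℝ (MvPolynomial (Fin 3) ℝ) (MvPolynomial (Fin 3) ℝ)),
      (pderiv j : Derivation ℝ (MvPolynomial (Fin 3) ℝ) (MvPolynomial (Fin 3) ℝ))⁆ = 0 := by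
    ext k
    simp [Derivation.commutator_apply, pderiv_X, Pi.single_apply, apply_ite]
  exact congrArg Derivation.toLinearMap this

theorem dop_eq_opHom (φ : MvPolynomial (Fin 3) ℝ) :
    dop φ = opHom (fun i => (pderiv i).toLinearMap) commute_pderiv φ := by
  rw [opHom_eq_sum]
  rfl

/-- The space of smooth real functions on `ℝ³`. -/
def smoothFn : Submodule ℝ (E3 → ℝ) where
  carrier := {g | ContDiff ℝ (⊤ : ℕ∞) g}
  add_mem' := fun {a b} ha hb => by
    rw [Set.mem_ofPred_eq] at *
    exact ha.add hb
  zero_mem' := by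
    rw [Set.mem_ofPred_eq]
    exact contDiff_const
  smul_mem' := fun c g h => by
    rw [Set.mem_ofPred_eq] at *
    exact contDiff_const.smul h

namespace smoothFn

theorem contDiff (g : smoothFn) : ContDiff ℝ (⊤ : ℕ∞) g.1 := g.2

theorem differentiable (g : smoothFn) : Differentiable ℝ g.1 :=
  (contDiff g).differentiable (by simp)

theorem continuous (g : smoothFn) : Continuous g.1 := (differentiable g).continuous

/-- The `i`-th partial derivative on smooth functions. -/
noncomputable def partialDeriv (i : Fin 3) : Module.End ℝ smoothFn where
  toFun g := ⟨fun x => fderiv ℝ g.1 x (EuclideanSpace.single i 1),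
    ((contDiff g).fderiv_right (m := (⊤ : ℕ∞)) (by simp)).clm_apply contDiff_const⟩
  map_add' g h := by
    ext x
    change fderiv ℝ (g.1 + h.1) x _ = _
    rw [fderiv_add ((differentiable g) x) ((differentiable h) x)]
    rfl
  map_smul' c g := by
    ext x
    change fderiv ℝ (c • g.1) x _ = _
    rw [fderiv_const_smul ((differentiable g) x)]
    rfl

theorem partialDeriv_apply (i : Fin 3) (g : smoothFn) (x : E3) :
    (partialDeriv i g).1 x = fderiv ℝ g.1 x (EuclideanSpace.single i 1) := rfl

theorem commute_partialDeriv (i j : Fin 3) : Commute (partialDeriv i) (partialDeriv j) := by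
  have key : ∀ (i j : Fin 3) (g : smoothFn) (x : E3), (partialDeriv i (partialDeriv j g)).1 x =
      fderiv ℝ (fderiv ℝ g.1) x (EuclideanSpace.single i 1) (EuclideanSpace.single j 1) := by
    intro i j g x
    have hd : DifferentiableAt ℝ (fderiv ℝ g.1) x :=
      ((contDiff g).fderiv_right (m := (⊤ : ℕ∞)) (by simp)).differentiable (by simp) x
    rw [partialDeriv_apply]
    change fderiv ℝ (fun y => fderiv ℝ g.1 y (EuclideanSpace.single j 1)) x _ = _
    rw [fderiv_clm_apply hd (differentiableAt_const _)]
    simp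
  refine LinearMap.ext fun g => Subtype.ext (funext fun x => ?_)
  change (partialDeriv i (partialDeriv j g)).1 x = (partialDeriv j (partialDeriv i g)).1 x
  rw [key, key]
  exact (contDiff g).contDiffAt.isSymmSndFDerivAt (by
    rw [minSmoothness_of_isRCLikeNormedField]
    exact WithTop.coe_le_coe.2 (le_top : (2 : ℕ∞) ≤ ⊤)) _ _

/-- Constant-coefficient differential operators acting on smooth functions. -/
noncomputable def diffOp : MvPolynomial (Fin 3) ℝ →ₐ[ℝ] Module.End ℝ smoothFn :=
  opHom partialDeriv commute_partialDeriv

theorem diffOp_X (i : Fin 3) : diffOp (X i) = partialDeriv i := opHom_X _ _ i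

theorem diffOp_mul_apply (φ ψ : MvPolynomial (Fin 3) ℝ) (g : smoothFn) :
    diffOp (φ * ψ) g = diffOp φ (diffOp ψ g) := by
  rw [map_mul]; rfl

/-- The ideal of differential operators annihilating `g`. -/
noncomputable def annihilator (g : smoothFn) : Ideal (MvPolynomial (Fin 3) ℝ) where
  carrier := {φ | diffOp φ g = 0}
  add_mem' := fun {a b} ha hb => by
    simp only [Set.mem_ofPred_eq] at *
    rw [map_add, LinearMap.add_apply, ha, hb, add_zero]
  zero_mem' := by simp
  smul_mem' := fun c φ h => by
    simp only [Set.mem_ofPred_eq, smul_eq_mul] at *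
    rw [diffOp_mul_apply, h, map_zero]

theorem mem_annihilator {g : smoothFn} {φ : MvPolynomial (Fin 3) ℝ} :
    φ ∈ annihilator g ↔ diffOp φ g = 0 := Iff.rfl

theorem hasFDerivAt_eval (p : MvPolynomial (Fin 3) ℝ) (x : E3) :
    HasFDerivAt (fun y : E3 => eval (toFn y) p)
      (∑ i, eval (toFn x) (pderiv i p) • (EuclideanSpace.proj i : E3 →L[ℝ] ℝ)) x := by
  induction p using MvPolynomial.induction_on with
  | C a => simpa using hasFDerivAt_const a x
  | add p q hp hq =>
    simp only [map_add, add_smul, Finset.sum_add_distrib]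
    exact hp.add hq
  | mul_X p i hp =>
    have hX : HasFDerivAt (fun y : E3 => toFn y i) (EuclideanSpace.proj i : E3 →L[ℝ] ℝ) x :=
      (EuclideanSpace.proj i : E3 →L[ℝ] ℝ).hasFDerivAt
    have := hp.mul hX
    simp only [map_mul, eval_X]
    convert! this using 1
    simp only [Derivation.leibniz, map_add, add_smul, Finset.sum_add_distrib, Finset.smul_sum,
      smul_eq_mul, map_mul, eval_X, smul_smul, pderiv_X]
    simp [Pi.single_apply, apply_ite]

/-- A polynomial as a smooth function. -/
noncomputable def ofPoly (p : MvPolynomial (Fin 3) ℝ) : smoothFn :=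
  ⟨fun y => eval (toFn y) p, by
    change ContDiff ℝ (⊤ : ℕ∞) fun y : E3 => eval (toFn y) p
    induction p using MvPolynomial.induction_on with
    | C a => simpa using contDiff_const
    | add p q hp hq => simpa using hp.add hq
    | mul_X p i hp =>
      have hX : ContDiff ℝ (⊤ : ℕ∞) fun y : E3 => toFn y i :=
        (EuclideanSpace.proj i : E3 →L[ℝ] ℝ).contDiff
      simpa using hp.mul hX⟩

theorem ofPoly_apply (p : MvPolynomial (Fin 3) ℝ) (y : E3) :
    (ofPoly p).1 y = eval (toFn y) p := rfl

theorem ofPoly_injective : Function.Injective ofPoly := by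
  intro p q h
  refine MvPolynomial.funext fun u => ?_
  exact congrFun (congrArg Subtype.val h) (pt u)

theorem partialDeriv_ofPoly (i : Fin 3) (p : MvPolynomial (Fin 3) ℝ) :
    partialDeriv i (ofPoly p) = ofPoly (pderiv i p) := by
  ext x
  rw [partialDeriv_apply]
  change fderiv ℝ (fun y : E3 => eval (toFn y) p) x _ = _
  rw [(hasFDerivAt_eval p x).fderiv, ofPoly_apply]
  simp

theorem ofPoly_add (p q : MvPolynomial (Fin 3) ℝ) : ofPoly (p + q) = ofPoly p + ofPoly q := by
  ext x; simp [ofPoly_apply]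

theorem ofPoly_zero : ofPoly 0 = 0 := by
  ext x; simp [ofPoly_apply]

theorem ofPoly_smul (c : ℝ) (p : MvPolynomial (Fin 3) ℝ) : ofPoly (c • p) = c • ofPoly p := by
  ext x; simp [ofPoly_apply]

theorem diffOp_ofPoly (φ p : MvPolynomial (Fin 3) ℝ) :
    diffOp φ (ofPoly p) = ofPoly (dop φ p) := by
  rw [dop_eq_opHom]
  induction φ using MvPolynomial.induction_on generalizing p with
  | C a =>
    rw [diffOp, opHom_C, opHom_C, Module.algebraMap_end_apply, Module.algebraMap_end_apply,
      ofPoly_smul]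
  | add φ ψ hφ hψ => simp only [map_add, LinearMap.add_apply, hφ, hψ, ofPoly_add]
  | mul_X φ i hφ =>
    rw [diffOp_mul_apply, diffOp_X, partialDeriv_ofPoly, hφ, map_mul, opHom_X]
    rfl

theorem mem_annihilator_ofPoly {φ p : MvPolynomial (Fin 3) ℝ} :
    φ ∈ annihilator (ofPoly p) ↔ dop φ p = 0 := by
  rw [mem_annihilator, diffOp_ofPoly, ← ofPoly_zero, ofPoly_injective.eq_iff]

theorem dop_mul_apply (φ ψ p : MvPolynomial (Fin 3) ℝ) : dop (φ * ψ) p = dop φ (dop ψ p) := by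
  simp only [dop_eq_opHom, map_mul]
  rfl

end smoothFn

namespace smoothFn

/-- The linear form `⟨y, ·⟩` as a polynomial. -/
noncomputable def linForm (y : E3) : MvPolynomial (Fin 3) ℝ := ∑ i, C (y i) * X i

theorem diffOp_C_mul_apply (c : ℝ) (φ : MvPolynomial (Fin 3) ℝ) (g : smoothFn) :
    diffOp (C c * φ) g = c • diffOp φ g := by
  rw [← smul_eq_C_mul, map_smul, LinearMap.smul_apply]

theorem diffOp_sum_apply {ι : Type*} (s : Finset ι) (φ : ι → MvPolynomial (Fin 3) ℝ)
    (g : smoothFn) (x : E3) :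
    (diffOp (∑ i ∈ s, φ i) g).1 x = ∑ i ∈ s, (diffOp (φ i) g).1 x := by
  rw [map_sum, LinearMap.sum_apply, AddSubmonoidClass.coe_finsetSum, Finset.sum_apply]

theorem diffOp_linForm_apply (y : E3) (g : smoothFn) (x : E3) :
    (diffOp (linForm y) g).1 x = fderiv ℝ g.1 x y := by
  have hy : y = ∑ i, y i • (EuclideanSpace.single i (1 : ℝ) : E3) := by
    ext j
    simp [Pi.single_apply]
  rw [linForm, diffOp_sum_apply]
  conv_rhs => rw [hy]
  simp only [map_sum, map_smul, diffOp_C_mul_apply, diffOp_X]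
  rfl

theorem linForm_pow (y : E3) (k : ℕ) :
    linForm y ^ k = ∑ α ∈ Finset.piAntidiag Finset.univ k,
      C (Nat.multinomial Finset.univ α * ∏ i, y i ^ α i) * ∏ i, X i ^ α i := by
  rw [linForm, Finset.sum_pow_eq_sum_piAntidiag]
  refine Finset.sum_congr rfl fun α _ => ?_
  simp only [mul_pow, Finset.prod_mul_distrib, map_mul, map_prod, map_pow, map_natCast]
  ring

theorem diffOp_linForm_pow_apply (y : E3) (k : ℕ) (g : smoothFn) (x : E3) :
    (diffOp (linForm y ^ k) g).1 x = ∑ α ∈ Finset.piAntidiag Finset.univ k,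
      (Nat.multinomial Finset.univ α * ∏ i, y i ^ α i) * (diffOp (∏ i, X i ^ α i) g).1 x := by
  rw [linForm_pow, diffOp_sum_apply]
  simp only [diffOp_C_mul_apply]
  rfl

theorem continuous_diffOp_linForm_pow (k : ℕ) (g : smoothFn) (x : E3) :
    Continuous fun q : ℝ × E3 => (diffOp (linForm q.2 ^ k) g).1 (x + q.1 • q.2) := by
  simp only [diffOp_linForm_pow_apply]
  refine continuous_finsetSum _ fun α _ => ?_
  have := continuous (diffOp (∏ i, X i ^ α i) g)
  fun_prop

theorem hasDerivAt_diffOp_linForm_pow (k : ℕ) (g : smoothFn) (x y : E3) (s : ℝ) :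
    HasDerivAt (fun s : ℝ => (diffOp (linForm y ^ k) g).1 (x + s • y))
      ((diffOp (linForm y ^ (k + 1)) g).1 (x + s • y)) s := by
  rw [pow_succ', diffOp_mul_apply, diffOp_linForm_apply]
  have h1 : HasDerivAt (fun s : ℝ => x + s • y) y s := by
    simpa using ((hasDerivAt_id s).smul_const y).const_add x
  exact (differentiable (diffOp (linForm y ^ k) g) _).hasFDerivAt.comp_hasDerivAt s h1

end smoothFn

section compactSupport

variable {ν : Measure E3} [IsFiniteMeasure ν] {K : Set E3}

theorem integrable_of_continuous (hK : IsCompact K) (hν : ν Kᶜ = 0) {h : E3 → ℝ}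
    (hh : Continuous h) : Integrable h ν := by
  rw [← Measure.restrict_eq_self_of_ae_mem (s := K) (μ := ν) (by rwa [ae_iff])]
  exact hh.continuousOn.integrableOn_compact hK

theorem hasDerivAt_integral_of_continuous (hK : IsCompact K) (hν : ν Kᶜ = 0)
    {F F' : ℝ × E3 → ℝ} (hF : Continuous F) (hF' : Continuous F')
    (hd : ∀ s y, HasDerivAt (fun s => F (s, y)) (F' (s, y)) s) (s : ℝ) :
    HasDerivAt (fun s => ∫ y, F (s, y) ∂ν) (∫ y, F' (s, y) ∂ν) s := by
  obtain ⟨B, hB⟩ := ((isCompact_closedBall s 1).prod hK).exists_bound_of_continuousOn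
    hF'.continuousOn
  refine (hasDerivAt_integral_of_dominated_loc_of_deriv_le (bound := fun _ => B)
    (F := fun s y => F (s, y)) (F' := fun s y => F' (s, y)) (x₀ := s)
    (Metric.ball_mem_nhds s one_pos) ?_ ?_ ?_ ?_ ?_ ?_).2
  · exact .of_forall fun s => (hF.comp (.prodMk_right s)).aestronglyMeasurable
  · exact integrable_of_continuous hK hν (hF.comp (.prodMk_right s))
  · exact (hF'.comp (.prodMk_right s)).aestronglyMeasurable
  · have : ∀ᵐ y ∂ν, y ∈ K := by rwa [ae_iff]
    filter_upwards [this] with y hy t ht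
    exact hB (t, y) ⟨Metric.ball_subset_closedBall ht, hy⟩
  · exact integrable_const B
  · exact .of_forall fun y t _ => hd t y

variable (ν) in
/-- The polynomial `x ↦ ∫ ⟨x, y⟩ ^ k dν(y)`. -/
noncomputable def momentPoly (k : ℕ) : MvPolynomial (Fin 3) ℝ :=
  ∑ α ∈ Finset.piAntidiag Finset.univ k,
    C (Nat.multinomial Finset.univ α * ∫ y, ∏ i, y i ^ α i ∂ν) * ∏ i, X i ^ α i

namespace smoothFn

variable (ν) in
/-- The `k`-th derivative in `s` of the mean of `g` over the dilate of `ν` centred at `x`. -/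
noncomputable def meanDeriv (g : smoothFn) (x : E3) (k : ℕ) (s : ℝ) : ℝ :=
  ∫ y, (diffOp (linForm y ^ k) g).1 (x + s • y) ∂ν

omit [IsFiniteMeasure ν] in
theorem meanDeriv_zero_left (g : smoothFn) (x : E3) (s : ℝ) :
    meanDeriv ν g x 0 s = ∫ y, g.1 (x + s • y) ∂ν := by
  simp [meanDeriv]

theorem hasDerivAt_meanDeriv (hK : IsCompact K) (hν : ν Kᶜ = 0) (g : smoothFn) (x : E3)
    (k : ℕ) (s : ℝ) : HasDerivAt (meanDeriv ν g x k) (meanDeriv ν g x (k + 1) s) s :=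
  hasDerivAt_integral_of_continuous hK hν (continuous_diffOp_linForm_pow k g x)
    (continuous_diffOp_linForm_pow (k + 1) g x)
    (fun s y => hasDerivAt_diffOp_linForm_pow k g x y s) s

theorem meanDeriv_zero_right (hK : IsCompact K) (hν : ν Kᶜ = 0) (g : smoothFn) (x : E3) (k : ℕ) :
    meanDeriv ν g x k 0 = (diffOp (momentPoly ν k) g).1 x := by
  rw [momentPoly, diffOp_sum_apply, meanDeriv]
  simp only [zero_smul, add_zero, diffOp_linForm_pow_apply]
  rw [integral_finsetSum _ fun α _ => integrable_of_continuous hK hν (by fun_prop)]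
  refine Finset.sum_congr rfl fun α _ => ?_
  rw [diffOp_C_mul_apply, integral_mul_const, integral_const_mul]
  rfl

/-- The moment polynomials annihilate every smooth function with the mean value property. -/
theorem momentPoly_mem_annihilator (hK : IsCompact K) (hν : ν Kᶜ = 0) {g : smoothFn} {V : ℝ}
    (hg : ∀ (x : E3) (s : ℝ), 0 < s → V * g.1 x = ∫ y, g.1 (x + s • y) ∂ν) {k : ℕ} (hk : 1 ≤ k) :
    momentPoly ν k ∈ annihilator g := by
  rw [mem_annihilator]
  ext x
  rw [← meanDeriv_zero_right hK hν]
  have hpos : ∀ k, 1 ≤ k → ∀ s, 0 < s → meanDeriv ν g x k s = 0 := by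
    intro k hk
    induction k, hk using Nat.le_induction with
    | base =>
      intro s hs
      refine (hasDerivAt_meanDeriv hK hν g x 0 s).unique ?_
      refine (hasDerivAt_const s (V * g.1 x)).congr_of_eventuallyEq ?_
      filter_upwards [lt_mem_nhds hs] with t ht
      rw [meanDeriv_zero_left, hg x t ht]
    | succ k hk ih =>
      intro s hs
      refine (hasDerivAt_meanDeriv hK hν g x k s).unique ?_
      refine (hasDerivAt_const s (0 : ℝ)).congr_of_eventuallyEq ?_
      filter_upwards [lt_mem_nhds hs] with t ht using ih t ht
  have hc : Filter.Tendsto (meanDeriv ν g x k) (nhdsWithin 0 (Set.Ioi 0))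
      (nhds (meanDeriv ν g x k 0)) :=
    (hasDerivAt_meanDeriv hK hν g x k 0).continuousAt.continuousWithinAt
  refine tendsto_nhds_unique hc ((tendsto_const_nhds (x := (0 : ℝ))).congr' ?_)
  filter_upwards [self_mem_nhdsWithin] with s hs using (hpos k hk s hs).symm

/-- A smooth function annihilated by the moment polynomials and by high powers of the partial
derivatives has the mean value property. -/
theorem mean_value_of_momentPoly_mem (hK : IsCompact K) (hν : ν Kᶜ = 0) {g : smoothFn} {N : ℕ}
    (hm : ∀ k, 1 ≤ k → momentPoly ν k ∈ annihilator g) (hN : ∀ i, X i ^ N ∈ annihilator g)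
    (x : E3) (s : ℝ) : ∫ y, g.1 (x + s • y) ∂ν = (ν Set.univ).toReal * g.1 x := by
  have hconst : ∀ k, (∀ s, meanDeriv ν g x (k + 1) s = 0) →
      ∀ s, meanDeriv ν g x k s = meanDeriv ν g x k 0 := by
    intro k hk s
    refine is_const_of_deriv_eq_zero
      (fun s => (hasDerivAt_meanDeriv hK hν g x k s).differentiableAt) (fun s => ?_) s 0
    rw [(hasDerivAt_meanDeriv hK hν g x k s).deriv, hk]
  have hbig : ∀ k, 3 * N ≤ k → 1 ≤ k → ∀ s, meanDeriv ν g x k s = 0 := by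
    intro k hk hk1 s
    have : ∀ y : E3, linForm y ^ k ∈ annihilator g := by
      intro y
      rw [linForm_pow]
      refine Ideal.sum_mem _ fun α hα => Ideal.mul_mem_left _ _ ?_
      rw [Finset.mem_piAntidiag] at hα
      obtain ⟨i, hi⟩ : ∃ i, N ≤ α i := by
        by_contra! h
        have := hα.1
        rw [Fin.sum_univ_three] at this
        have := h 0; have := h 1; have := h 2
        omega
      exact Ideal.mem_of_dvd _ ((pow_dvd_pow _ hi).trans
        (Finset.dvd_prod_of_mem (fun i => (X i : MvPolynomial (Fin 3) ℝ) ^ α i)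
          (Finset.mem_univ i))) (hN i)
    simp only [meanDeriv, mem_annihilator.1 (this _)]
    simp
  have hall : ∀ j k, 3 * N ≤ k + j → 1 ≤ k → ∀ s, meanDeriv ν g x k s = 0 := by
    intro j
    induction j with
    | zero => exact hbig
    | succ j ih =>
      intro k hk hk1 s
      rw [hconst k (ih (k + 1) (by omega) (by omega)) s, meanDeriv_zero_right hK hν,
        mem_annihilator.1 (hm k hk1)]
      rfl
  rw [← meanDeriv_zero_left, hconst 0 (hall (3 * N) 1 (by omega) le_rfl), meanDeriv_zero_left]
  simp [Measure.real]

end smoothFn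

end compactSupport

theorem eq_sum_of_hasDerivAt_of_eq_zero (N : ℕ) (h : ℕ → ℝ → ℝ)
    (hd : ∀ j t, HasDerivAt (h j) (h (j + 1) t) t) (hN : ∀ t, h N t = 0) (t : ℝ) :
    h 0 t = ∑ j ∈ Finset.range N, t ^ j / j.factorial * h j 0 := by
  induction N generalizing h t with
  | zero => simpa using hN t
  | succ N ih =>
    have h1 := ih (fun j => h (j + 1)) (fun j => hd (j + 1)) hN
    have hterm : ∀ j t, HasDerivAt (fun t : ℝ => t ^ (j + 1) / (j + 1).factorial * h (j + 1) 0)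
        (t ^ j / j.factorial * h (j + 1) 0) t := by
      intro j t
      have := ((hasDerivAt_pow (j + 1) t).div_const ((j + 1).factorial : ℝ)).mul_const (h (j + 1) 0)
      convert! this using 1
      rw [Nat.factorial_succ]
      push_cast
      field_simp
    have hdiff : ∀ t, HasDerivAt (fun t => h 0 t - ∑ j ∈ Finset.range N,
        t ^ (j + 1) / (j + 1).factorial * h (j + 1) 0) 0 t := by
      intro t
      have := (hd 0 t).sub (HasDerivAt.fun_sum (u := Finset.range N) fun j _ => hterm j t)
      rwa [← h1 t, sub_self] at this
    have := is_const_of_deriv_eq_zero (fun t => (hdiff t).differentiableAt)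
      (fun t => (hdiff t).deriv) t 0
    simp only [ne_eq, Nat.add_eq_zero_iff, one_ne_zero, and_false, not_false_eq_true, zero_pow,
      zero_div, zero_mul, Finset.sum_const_zero, sub_zero] at this
    rw [Finset.sum_range_succ', ← this]
    simp

/-- The functions on `ℝ³` given by polynomials of degree less than `N` in each variable. -/
def boxPolyFn (N : ℕ) : Submodule ℝ (E3 → ℝ) :=
  Submodule.span ℝ (Set.range fun α : Fin 3 → Fin N => fun x : E3 => ∏ i, x i ^ (α i : ℕ))

theorem exists_poly_of_mem_boxPolyFn {N : ℕ} {f : E3 → ℝ} (hf : f ∈ boxPolyFn N) :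
    ∃ p, f = (smoothFn.ofPoly p).1 := by
  induction hf using Submodule.span_induction with
  | mem f h =>
    obtain ⟨α, rfl⟩ := h
    refine ⟨∏ i, X i ^ (α i : ℕ), funext fun x => ?_⟩
    rw [smoothFn.ofPoly_apply, map_prod]
    simp [toFn]
  | zero => exact ⟨0, by rw [smoothFn.ofPoly_zero]; rfl⟩
  | add f g _ _ hf hg =>
    obtain ⟨p, rfl⟩ := hf
    obtain ⟨q, rfl⟩ := hg
    exact ⟨p + q, by rw [smoothFn.ofPoly_add]; rfl⟩
  | smul c f _ hf =>
    obtain ⟨p, rfl⟩ := hf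
    exact ⟨c • p, by rw [smoothFn.ofPoly_smul]; rfl⟩

theorem isClosed_boxPolyFn (N : ℕ) : IsClosed (boxPolyFn N : Set (E3 → ℝ)) := by
  have : FiniteDimensional ℝ (boxPolyFn N) :=
    FiniteDimensional.span_of_finite ℝ (Set.finite_range _)
  exact Submodule.closed_of_finiteDimensional _

namespace smoothFn

theorem taylor_of_X_pow_mem {g : smoothFn} {N : ℕ} {i : Fin 3} (hN : X i ^ N ∈ annihilator g)
    (x : E3) (t : ℝ) : g.1 (x + t • EuclideanSpace.single i 1) =
      ∑ j ∈ Finset.range N, t ^ j / j.factorial * (diffOp (X i ^ j) g).1 x := by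
  have := eq_sum_of_hasDerivAt_of_eq_zero N
    (fun j t => (diffOp (X i ^ j) g).1 (x + t • EuclideanSpace.single i 1)) (fun j t => by
      rw [pow_succ', diffOp_mul_apply, diffOp_X, partialDeriv_apply]
      have h1 : HasDerivAt (fun s : ℝ => x + s • (EuclideanSpace.single i 1 : E3))
          (EuclideanSpace.single i 1) t := by
        simpa using ((hasDerivAt_id t).smul_const (EuclideanSpace.single i 1 : E3)).const_add x
      exact (differentiable (diffOp (X i ^ j) g) _).hasFDerivAt.comp_hasDerivAt t h1)
    (fun t => by rw [mem_annihilator.1 hN]; rfl) t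
  simpa using this

theorem mem_annihilator_diffOp {g : smoothFn} {φ : MvPolynomial (Fin 3) ℝ}
    (h : φ ∈ annihilator g) (ψ : MvPolynomial (Fin 3) ℝ) : φ ∈ annihilator (diffOp ψ g) := by
  rw [mem_annihilator, ← diffOp_mul_apply]
  exact Ideal.mul_mem_right _ _ h

theorem mem_boxPolyFn {g : smoothFn} {N : ℕ} (hN : ∀ i, X i ^ N ∈ annihilator g) :
    g.1 ∈ boxPolyFn N := by
  have hg : g.1 = ∑ i ∈ Finset.range N, ∑ j ∈ Finset.range N, ∑ k ∈ Finset.range N,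
      ((1 / i.factorial * (1 / j.factorial) * (1 / k.factorial) : ℝ) *
        (diffOp (X 2 ^ k) (diffOp (X 1 ^ j) (diffOp (X 0 ^ i) g))).1 0) •
      fun x : E3 => x 0 ^ i * x 1 ^ j * x 2 ^ k := by
    funext x
    have hx : x = ((0 + x 2 • EuclideanSpace.single 2 1) + x 1 • EuclideanSpace.single 1 1) +
        x 0 • EuclideanSpace.single 0 1 := by
      ext j
      fin_cases j <;> simp
    conv_lhs => rw [hx]
    simp only [Finset.sum_apply]
    rw [taylor_of_X_pow_mem (hN 0)]
    refine Finset.sum_congr rfl fun i _ => ?_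
    rw [taylor_of_X_pow_mem (mem_annihilator_diffOp (hN 1) _), Finset.mul_sum]
    refine Finset.sum_congr rfl fun j _ => ?_
    rw [taylor_of_X_pow_mem (mem_annihilator_diffOp (mem_annihilator_diffOp (hN 2) _) _),
      Finset.mul_sum, Finset.mul_sum]
    refine Finset.sum_congr rfl fun k _ => ?_
    simp only [Pi.smul_apply, smul_eq_mul]
    ring
  rw [hg]
  refine Submodule.sum_mem _ fun i hi => Submodule.sum_mem _ fun j hj =>
    Submodule.sum_mem _ fun k hk => Submodule.smul_mem _ _ (Submodule.subset_span ?_)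
  rw [Finset.mem_range] at hi hj hk
  refine ⟨![⟨i, hi⟩, ⟨j, hj⟩, ⟨k, hk⟩], funext fun x => ?_⟩
  simp [Fin.prod_univ_three]

end smoothFn

section mollification

variable {ν : Measure E3} [IsFiniteMeasure ν] {K : Set E3}

open scoped Convolution

/-- The convolution of a continuous function with a smooth bump function. -/
noncomputable def mollify (φ : ContDiffBump (0 : E3)) (f : E3 → ℝ) (hf : Continuous f) : smoothFn :=
  ⟨φ.normed volume ⋆[ContinuousLinearMap.lsmul ℝ ℝ, volume] f, by
    change ContDiff ℝ (⊤ : ℕ∞) _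
    exact φ.hasCompactSupport_normed.contDiff_convolution_left _ φ.contDiff_normed
      hf.locallyIntegrable⟩

theorem mollify_apply (φ : ContDiffBump (0 : E3)) (f : E3 → ℝ) (hf : Continuous f) (x : E3) :
    (mollify φ f hf).1 x = ∫ t, φ.normed volume t * f (x - t) := rfl

theorem mollify_mean_value (hK : IsCompact K) (hν : ν Kᶜ = 0) {f : E3 → ℝ} (hf : Continuous f)
    {V s : ℝ} (hV : ∀ x : E3, V * f x = ∫ y, f (x + s • y) ∂ν)
    (φ : ContDiffBump (0 : E3)) (x : E3) :
    V * (mollify φ f hf).1 x = ∫ y, (mollify φ f hf).1 (x + s • y) ∂ν := by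
  simp only [mollify_apply]
  have hcont : Continuous fun q : E3 × E3 => φ.normed volume q.2 * f (x + s • q.1 - q.2) := by
    have := (φ.contDiff_normed (μ := volume) (n := 0)).continuous
    fun_prop
  rw [integral_integral_swap, ← integral_const_mul]
  · refine integral_congr_ae (.of_forall fun t => ?_)
    simp only
    rw [integral_const_mul, mul_left_comm, hV]
    simp only [add_sub_right_comm]
  · set L := tsupport (φ.normed (volume : Measure E3))
    have hL : IsCompact L := φ.hasCompactSupport_normed
    rw [← integrableOn_univ]
    have h1 : IntegrableOn (Function.uncurry fun y t =>
        φ.normed volume t * f (x + s • y - t)) (K ×ˢ L) (ν.prod volume) :=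
      hcont.continuousOn.integrableOn_compact (hK.prod hL)
    have hK' : ∀ᵐ q ∂(ν.prod (volume : Measure E3)), q.1 ∈ K :=
      Measure.quasiMeasurePreserving_fst.ae (by rwa [ae_iff])
    refine h1.of_ae_sdiff_eq_zero nullMeasurableSet_univ ?_
    filter_upwards [hK'] with q hq hq'
    have : q.2 ∉ L := fun h => hq'.2 ⟨hq, h⟩
    simp [Function.uncurry, image_eq_zero_of_notMem_tsupport this]

/-- A continuous function with the mean value property is a polynomial, provided that high powers
of the partial derivatives annihilate all smooth functions with the mean value property. -/
theorem exists_poly_of_mean_value (hK : IsCompact K) (hν : ν Kᶜ = 0) {f : E3 → ℝ}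
    (hf : Continuous f) {V : ℝ}
    (hV : ∀ (x : E3) (s : ℝ), 0 < s → V * f x = ∫ y, f (x + s • y) ∂ν) {N : ℕ}
    (hN : ∀ i, X i ^ N ∈ Ideal.span {φ | ∃ k, 1 ≤ k ∧ φ = momentPoly ν k}) :
    ∃ p, f = (smoothFn.ofPoly p).1 := by
  have hmoll : ∀ φ : ContDiffBump (0 : E3), (mollify φ f hf).1 ∈ boxPolyFn N := by
    intro φ
    refine smoothFn.mem_boxPolyFn fun i => (Ideal.span_le.2 ?_) (hN i)
    rintro _ ⟨k, hk, rfl⟩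
    exact smoothFn.momentPoly_mem_annihilator hK hν
      (fun x s hs => mollify_mean_value hK hν hf (fun x => hV x s hs) φ x) hk
  let φ : ℕ → ContDiffBump (0 : E3) := fun n =>
    ⟨1 / (n + 1) / 2, 1 / (n + 1), by positivity, half_lt_self (by positivity)⟩
  have hlim : Filter.Tendsto (fun n => (mollify (φ n) f hf).1) Filter.atTop (nhds f) :=
    tendsto_pi_nhds.2 fun x => ContDiffBump.convolution_tendsto_right_of_continuous
      tendsto_one_div_add_atTop_nhds_zero_nat hf x
  exact exists_poly_of_mem_boxPolyFn
    ((isClosed_boxPolyFn N).mem_of_tendsto hlim (.of_forall fun n => hmoll (φ n)))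

end mollification

/-- The isometry of `ℝ³` that permutes the coordinates by `σ` and changes their signs by `ε`. -/
noncomputable def signedPerm (ε : Fin 3 → Bool) (σ : Equiv.Perm (Fin 3)) : E3 ≃ₗᵢ[ℝ] E3 :=
  (LinearIsometryEquiv.piLpCongrLeft 2 ℝ ℝ σ.symm).trans
    (LinearIsometryEquiv.piLpCongrRight 2 fun i =>
      if ε i then LinearIsometryEquiv.refl ℝ ℝ else LinearIsometryEquiv.neg ℝ)

theorem signedPerm_apply (ε : Fin 3 → Bool) (σ : Equiv.Perm (Fin 3)) (x : E3) (i : Fin 3) :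
    signedPerm ε σ x i = sg (ε i) * x (σ i) := by
  have : signedPerm ε σ x i = (if ε i then LinearIsometryEquiv.refl ℝ ℝ
    else LinearIsometryEquiv.neg ℝ) (x (σ i)) := rfl
  rw [this, sg]
  split_ifs <;> simp

/-- Invariance of a measure under the symmetry group of the octahedron. -/
def IsOctahedral (ν : Measure E3) : Prop :=
  ∀ ε σ, MeasurePreserving (signedPerm ε σ) ν ν

namespace IsOctahedral

variable {ν : Measure E3}

theorem integral_comp (hν : IsOctahedral ν) (ε : Fin 3 → Bool) (σ : Equiv.Perm (Fin 3))
    (q : E3 → ℝ) : ∫ y, q (signedPerm ε σ y) ∂ν = ∫ y, q y ∂ν :=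
  (hν ε σ).integral_comp (signedPerm ε σ).toHomeomorph.measurableEmbedding q

theorem integral_monomial_perm (hν : IsOctahedral ν) (σ : Equiv.Perm (Fin 3)) (α : Fin 3 → ℕ) :
    ∫ y, ∏ i, y i ^ α (σ i) ∂ν = ∫ y, ∏ i, y i ^ α i ∂ν := by
  rw [← hν.integral_comp (fun _ => true) σ]
  refine integral_congr_ae (.of_forall fun y => ?_)
  simp only [signedPerm_apply, sg, if_true, one_mul]
  exact Equiv.prod_comp σ fun i => y i ^ α i

theorem integral_monomial_of_odd (hν : IsOctahedral ν) {α : Fin 3 → ℕ} {i : Fin 3}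
    (hi : Odd (α i)) : ∫ y, ∏ i, y i ^ α i ∂ν = 0 := by
  have h := hν.integral_comp (fun j => decide (j ≠ i)) 1 fun y : E3 => ∏ i, y i ^ α i
  have : ∀ y : E3, ∏ j, (signedPerm (fun j => decide (j ≠ i)) 1 y) j ^ α j =
      - ∏ j, y j ^ α j := by
    intro y
    simp only [signedPerm_apply, mul_pow, Finset.prod_mul_distrib, Equiv.Perm.one_apply]
    rw [Finset.prod_eq_single i]
    · simp [sg, hi.neg_one_pow]
    · intro j _ hj
      simp [sg, hj]
    · simp
  simp only [this, integral_neg] at h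
  linarith

end IsOctahedral

/-- The coefficient of `∏ i, x i ^ (2 * β i)` in `⟨x, y⟩ ^ (2 * ∑ i, β i)`, integrated over `y`. -/
noncomputable def evenMomentCoeff (ν : Measure E3) (β : Fin 3 → ℕ) : ℝ :=
  Nat.multinomial Finset.univ (2 • β) * ∫ y, ∏ i, y i ^ (2 • β) i ∂ν

/-- The moment polynomial of degree `2 * n`, as a polynomial in the squares of the variables. -/
noncomputable def evenMomentPoly (ν : Measure E3) (n : ℕ) : MvPolynomial (Fin 3) ℝ :=
  ∑ β ∈ Finset.piAntidiag Finset.univ n, C (evenMomentCoeff ν β) * ∏ i, X i ^ β i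

theorem evenMomentPoly_isHomogeneous (ν : Measure E3) (n : ℕ) :
    (evenMomentPoly ν n).IsHomogeneous n := by
  refine IsHomogeneous.sum _ _ _ fun β hβ => ?_
  rw [Finset.mem_piAntidiag] at hβ
  have h1 : (∏ i, X i ^ β i : MvPolynomial (Fin 3) ℝ).IsHomogeneous (∑ i, β i) :=
    IsHomogeneous.prod _ _ _ fun i _ => by simpa using (isHomogeneous_X ℝ i).pow (β i)
  simpa [hβ.1] using (isHomogeneous_C (Fin 3) (evenMomentCoeff ν β)).mul h1

theorem multinomial_comp_perm (σ : Equiv.Perm (Fin 3)) (α : Fin 3 → ℕ) :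
    Nat.multinomial Finset.univ (fun i => α (σ i)) = Nat.multinomial Finset.univ α := by
  simp only [Nat.multinomial]
  rw [Equiv.sum_comp σ α, Equiv.prod_comp σ fun i => (α i).factorial]

section
variable {ν : Measure E3} (hν : IsOctahedral ν)
include hν

theorem evenMomentPoly_isSymmetric (n : ℕ) : (evenMomentPoly ν n).IsSymmetric := by
  intro σ
  rw [evenMomentPoly, map_sum]
  refine Finset.sum_nbij' (fun β => β ∘ σ.symm) (fun β => β ∘ σ) ?_ ?_ ?_ ?_ ?_
  · intro β hβ
    rw [Finset.mem_piAntidiag] at hβ ⊢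
    exact ⟨by simpa [Equiv.sum_comp σ.symm β] using hβ.1, by simp⟩
  · intro β hβ
    rw [Finset.mem_piAntidiag] at hβ ⊢
    exact ⟨by simpa [Equiv.sum_comp σ β] using hβ.1, by simp⟩
  · intro β _; ext i; simp
  · intro β _; ext i; simp
  · intro β _
    have h1 : evenMomentCoeff ν (β ∘ σ.symm) = evenMomentCoeff ν β := by
      rw [evenMomentCoeff, evenMomentCoeff, ← multinomial_comp_perm σ.symm (2 • β),
        ← hν.integral_monomial_perm σ.symm (2 • β)]
      rfl
    rw [h1, map_mul, rename_C, map_prod, ← Equiv.prod_comp σ fun i => X i ^ (β ∘ σ.symm) i]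
    simp

theorem momentPoly_two_mul (n : ℕ) : momentPoly ν (2 * n) = expand 2 (evenMomentPoly ν n) := by
  have h1 : expand 2 (evenMomentPoly ν n) = ∑ α ∈ (Finset.piAntidiag Finset.univ n).map
      ⟨(2 • ·), nsmul_right_injective two_ne_zero⟩,
      C (Nat.multinomial Finset.univ α * ∫ y, ∏ i, y i ^ α i ∂ν) *
        ∏ i, (X i ^ α i : MvPolynomial (Fin 3) ℝ) := by
    rw [Finset.sum_map, evenMomentPoly, map_sum]
    refine Finset.sum_congr rfl fun β _ => ?_
    rw [map_mul, expand_C, map_prod]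
    simp only [map_pow, expand_X, ← pow_mul]
    rfl
  rw [h1, momentPoly]
  refine (Finset.sum_subset (fun α hα => ?_) fun α hα hα' => ?_).symm
  · obtain ⟨β, hβ, rfl⟩ := Finset.mem_map.1 hα
    rw [Finset.mem_piAntidiag] at hβ ⊢
    simp [← Finset.mul_sum, hβ.1]
  · obtain ⟨i, hi⟩ : ∃ i, Odd (α i) := by
      by_contra! h
      choose β hβ using fun i => even_iff_two_dvd.1 (Nat.not_odd_iff_even.1 (h i))
      refine hα' (Finset.mem_map.2 ⟨β, ?_, funext fun i => (hβ i).symm⟩)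
      rw [Finset.mem_piAntidiag] at hα ⊢
      refine ⟨?_, by simp⟩
      have := hα.1
      simp only [hβ, ← Finset.mul_sum] at this
      exact Nat.eq_of_mul_eq_mul_left two_pos this
    rw [hν.integral_monomial_of_odd hi]
    simp

theorem momentPoly_eq_zero_of_odd {k : ℕ} (hk : Odd k) : momentPoly ν k = 0 := by
  refine Finset.sum_eq_zero fun α hα => ?_
  rw [Finset.mem_piAntidiag] at hα
  obtain ⟨i, hi⟩ : ∃ i, Odd (α i) := by
    by_contra! h
    simp only [Nat.not_odd_iff_even] at h
    have : Even k := hα.1 ▸ Finset.even_sum _ fun i _ => h i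
    exact Nat.not_even_iff_odd.2 hk this
  rw [hν.integral_monomial_of_odd hi]
  simp

end

theorem expand_s1 : expand 2 s1 = e2 := by simp [s1, e2]

theorem expand_s2 : expand 2 s2 = e4 := by simp [s2, e4]

theorem expand_s3 : expand 2 s3 = e6 := by simp [s3, e6]

section
variable {ν : Measure E3} (hν : IsOctahedral ν)
include hν

theorem momentPoly_mem_span {I : Ideal (MvPolynomial (Fin 3) ℝ)} {S : Set (MvPolynomial (Fin 3) ℝ)}
    (hS : ∀ p ∈ S, expand 2 p ∈ I) (h : ∀ n, 1 ≤ n → evenMomentPoly ν n ∈ Ideal.span S)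
    {k : ℕ} (hk : 1 ≤ k) : momentPoly ν k ∈ I := by
  rcases Nat.even_or_odd' k with ⟨n, rfl | rfl⟩
  · rw [momentPoly_two_mul hν]
    have : Ideal.span S ≤ I.comap (expand 2) := Ideal.span_le.2 hS
    exact this (h n (by omega))
  · rw [momentPoly_eq_zero_of_odd hν (odd_two_mul_add_one n)]
    exact I.zero_mem

theorem momentPoly_mem_of_e2_e4_e6 {I : Ideal (MvPolynomial (Fin 3) ℝ)} (h2 : e2 ∈ I)
    (h4 : e4 ∈ I) (h6 : e6 ∈ I) {k : ℕ} (hk : 1 ≤ k) : momentPoly ν k ∈ I := by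
  refine momentPoly_mem_span hν (S := {s1, s2, s3}) ?_ (fun n hn => symm_mem_span_s1_s2_s3 hn
    (evenMomentPoly_isSymmetric hν n) (evenMomentPoly_isHomogeneous ν n)) hk
  rintro p (rfl | rfl | rfl)
  · rwa [expand_s1]
  · rwa [expand_s2]
  · rwa [expand_s3]

theorem momentPoly_mem_of_e2_e6_e4_sq {I : Ideal (MvPolynomial (Fin 3) ℝ)} (h2 : e2 ∈ I)
    (h6 : e6 ∈ I) (h4 : e4 ^ 2 ∈ I) (h0 : eval ![1, -1, 0] (evenMomentPoly ν 2) = 0)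
    {k : ℕ} (hk : 1 ≤ k) : momentPoly ν k ∈ I := by
  refine momentPoly_mem_span hν (S := {s1, s3, s2 ^ 2}) ?_ (fun n hn => ?_) hk
  · rintro p (rfl | rfl | rfl)
    · rwa [expand_s1]
    · rwa [expand_s3]
    · rwa [map_pow, expand_s2]
  · have hs := evenMomentPoly_isSymmetric hν n
    have hh := evenMomentPoly_isHomogeneous ν n
    have hle : Ideal.span {s1} ≤ Ideal.span {s1, s3, s2 ^ 2} := Ideal.span_mono (by simp)
    obtain rfl | rfl | hn : n = 1 ∨ n = 2 ∨ 3 ≤ n := by omega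
    · obtain ⟨d, hd⟩ := exists_sub_mem_of_symmMonomials (fun _ => symmMonomials_one) hs hh
      rw [Ideal.mem_bot, sub_eq_zero] at hd
      rw [hd]
      exact Ideal.mul_mem_left _ _ (Ideal.subset_span (by simp))
    · obtain ⟨d, hd⟩ := exists_sub_mem_of_symmMonomials (fun _ => symmMonomials_two) hs hh
      rw [eval_eq_of_sub_mem (span_s1_le_ker (by simp)) hd] at h0
      obtain rfl : d = 0 := by simpa [s2] using h0
      exact hle (by simpa using hd)
    · exact symm_mem_span_s1_s3_s2_sq hn hs hh

variable {J : Ideal (MvPolynomial (Fin 3) ℝ)} (hJ : ∀ k, 1 ≤ k → momentPoly ν k ∈ J)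
include hJ

theorem evenMomentPoly_mem_comap {n : ℕ} (hn : 1 ≤ n) :
    evenMomentPoly ν n ∈ J.comap (expand 2) := by
  rw [Ideal.mem_comap, ← momentPoly_two_mul hν]
  exact hJ _ (by omega)

theorem s1_mem_comap (h1 : eval ![1, 0, 0] (evenMomentPoly ν 1) ≠ 0) :
    s1 ∈ J.comap (expand 2) :=
  mem_of_symm (fun _ => symmMonomials_one) bot_le bot_le
    (evenMomentPoly_mem_comap hν hJ le_rfl) (evenMomentPoly_isSymmetric hν 1)
    (evenMomentPoly_isHomogeneous ν 1) h1

theorem s2_mem_comap (h1 : s1 ∈ J.comap (expand 2))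
    (h2 : eval ![1, -1, 0] (evenMomentPoly ν 2) ≠ 0) : s2 ∈ J.comap (expand 2) :=
  mem_of_symm (fun _ => symmMonomials_two) (by simpa [Ideal.span_le] using h1)
    (span_s1_le_ker (by simp)) (evenMomentPoly_mem_comap hν hJ one_le_two)
    (evenMomentPoly_isSymmetric hν 2) (evenMomentPoly_isHomogeneous ν 2) h2

theorem s3_mem_comap (h1 : s1 ∈ J.comap (expand 2))
    (h3 : eval ![1, 1, -2] (evenMomentPoly ν 3) ≠ 0) : s3 ∈ J.comap (expand 2) :=
  mem_of_symm (fun _ => symmMonomials_three) (by simpa [Ideal.span_le] using h1)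
    (span_s1_le_ker (by simp; norm_num)) (evenMomentPoly_mem_comap hν hJ (by norm_num))
    (evenMomentPoly_isSymmetric hν 3) (evenMomentPoly_isHomogeneous ν 3) h3

theorem s2_sq_mem_comap (h1 : s1 ∈ J.comap (expand 2)) (h3 : s3 ∈ J.comap (expand 2))
    (h4 : eval ![1, -1, 0] (evenMomentPoly ν 4) ≠ 0) : s2 ^ 2 ∈ J.comap (expand 2) :=
  mem_of_symm (fun _ => symmMonomials_four)
    (by simpa [Ideal.span_le, Set.insert_subset_iff] using ⟨h1, h3⟩)
    (Ideal.span_le.2 (by simp [Set.insert_subset_iff, RingHom.mem_ker, s1, s3]))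
    (evenMomentPoly_mem_comap hν hJ (by norm_num))
    (evenMomentPoly_isSymmetric hν 4) (evenMomentPoly_isHomogeneous ν 4) h4

end

/-- The two-dimensional Hausdorff measure on an affinely parametrized plane is a multiple of the
Lebesgue measure of the parameters. -/
theorem exists_comap_hausdorffMeasure_eq_smul (L : ℝ × ℝ →ₗ[ℝ] E3) (hL : Function.Injective L)
    (b : E3) : ∃ c : NNReal, c ≠ 0 ∧
      (μH[2] : Measure E3).comap (fun p => b + L p) = c • (volume : Measure (ℝ × ℝ)) := by
  have hemb : MeasurableEmbedding fun p => b + L p :=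
    ((Homeomorph.addLeft b).isClosedEmbedding.comp
      (LinearMap.isClosedEmbedding_of_injective (LinearMap.ker_eq_bot.2 hL))).measurableEmbedding
  have himage (s : Set (ℝ × ℝ)) :
      (μH[2] : Measure E3).comap (fun p => b + L p) s = μH[2] (L '' s) := by
    rw [hemb.comap_apply, ← (IsometryEquiv.addLeft b).hausdorffMeasure_image 2 (L '' s),
      ← Set.image_comp]
    rfl
  have hadd : ((μH[2] : Measure E3).comap fun p => b + L p).IsAddLeftInvariant := by
    refine ⟨fun v => Measure.ext fun s hs => ?_⟩
    rw [Measure.map_apply (measurable_const_add v) hs, himage, himage,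
      ← (IsometryEquiv.addLeft (L v)).hausdorffMeasure_image, ← Set.image_comp]
    congr 1
    ext x
    constructor
    · rintro ⟨p, hp, rfl⟩
      exact ⟨v + p, hp, by simp⟩
    · rintro ⟨p, hp, rfl⟩
      exact ⟨-v + p, by simpa using hp, by simp⟩
  have hfin : IsFiniteMeasureOnCompacts ((μH[2] : Measure E3).comap fun p => b + L p) := by
    refine ⟨fun s hs => ?_⟩
    rw [himage]
    refine (L.toContinuousLinearMap.lipschitz.hausdorffMeasure_image_le zero_le_two s).trans_lt ?_
    rw [hausdorffMeasure_prod_real]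
    exact ENNReal.mul_lt_top (by simp) hs.measure_lt_top
  have h := Measure.isAddLeftInvariant_eq_smul
    ((μH[2] : Measure E3).comap fun p => b + L p) (volume : Measure (ℝ × ℝ))
  refine ⟨_, fun h0 => ?_, h⟩
  rw [h0, zero_smul] at h
  have huniv := himage Set.univ
  rw [h, Measure.coe_zero, Pi.zero_apply] at huniv
  obtain ⟨K, -, hK⟩ := L.exists_antilipschitzWith (LinearMap.ker_eq_bot.2 hL)
  have := hK.le_hausdorffMeasure_image zero_le_two Set.univ
  rw [← huniv, mul_zero, hausdorffMeasure_prod_real] at this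
  simp at this

/-- The affine parametrization of the plane of one face of the triakis octahedron. -/
noncomputable def facePoint (r : ℝ) (p : ℝ × ℝ) : E3 :=
  pt ![p.1 + p.2 * r / 3, 1 - p.1 - p.2 + p.2 * r / 3, p.2 * r / 3]

/-- The parameters of the points of a face. -/
def simplex : Set (ℝ × ℝ) := {p | 0 ≤ p.1 ∧ 0 ≤ p.2 ∧ p.1 + p.2 ≤ 1}

/-- The parameters of the interior points of a face. -/
def openSimplex : Set (ℝ × ℝ) := {p | 0 < p.1 ∧ 0 < p.2 ∧ p.1 + p.2 < 1}

theorem mem_simplex {p : ℝ × ℝ} : p ∈ simplex ↔ 0 ≤ p.1 ∧ 0 ≤ p.2 ∧ p.1 + p.2 ≤ 1 := by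
  rw [simplex, Set.mem_ofPred_eq]

theorem mem_openSimplex {p : ℝ × ℝ} : p ∈ openSimplex ↔ 0 < p.1 ∧ 0 < p.2 ∧ p.1 + p.2 < 1 := by
  rw [openSimplex, Set.mem_ofPred_eq]

theorem convex_simplex : Convex ℝ simplex := by
  intro p hp q hq a b ha hb hab
  rw [mem_simplex] at *
  simp only [Prod.fst_add, Prod.snd_add, Prod.smul_fst, Prod.smul_snd, smul_eq_mul]
  refine ⟨by nlinarith, by nlinarith, ?_⟩
  nlinarith

theorem isClosed_simplex : IsClosed simplex :=
  (isClosed_le continuous_const continuous_fst).inter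
    ((isClosed_le continuous_const continuous_snd).inter
      (isClosed_le (continuous_fst.add continuous_snd) continuous_const))

theorem isCompact_simplex : IsCompact simplex := by
  refine (isCompact_Icc (a := ((0 : ℝ), (0 : ℝ))) (b := (1, 1))).of_isClosed_subset
    isClosed_simplex fun p hp => ?_
  rw [mem_simplex] at hp
  exact ⟨⟨hp.1, hp.2.1⟩, ⟨by simpa using by linarith, by simpa using by linarith⟩⟩

theorem volume_simplex_diff_openSimplex : volume (simplex \ openSimplex) = 0 := by
  refine measure_mono_null ?_ (convex_simplex.addHaar_frontier volume)
  rw [isClosed_simplex.frontier_eq]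
  refine Set.sdiff_subset_sdiff_right fun p hp => ?_
  obtain ⟨δ, hδ, hball⟩ := Metric.mem_nhds_iff.1 (mem_interior_iff_mem_nhds.1 hp)
  have hmem (t : ℝ) (ht : |t| < δ) : (p.1 + t, p.2 + t) ∈ simplex := by
    refine hball ?_
    rw [Metric.mem_ball, Prod.dist_eq]
    simpa using ht
  have h1 := mem_simplex.1 (hmem (δ / 2) (by rw [abs_of_pos] <;> linarith))
  have h2 := mem_simplex.1 (hmem (-(δ / 2)) (by rw [abs_neg, abs_of_pos] <;> linarith))
  exact mem_openSimplex.2 ⟨by linarith [h2.1], by linarith [h2.2.1], by linarith [h1.2.2]⟩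

theorem continuous_facePoint (r : ℝ) : Continuous (facePoint r) := by
  refine (PiLp.continuous_toLp 2 _).comp (continuous_pi fun i => ?_)
  fin_cases i <;> simp <;> fun_prop

section

variable {r : ℝ}

theorem exists_comap_facePoint (hr : 0 < r) : ∃ c : NNReal, c ≠ 0 ∧
    (μH[2] : Measure E3).comap (facePoint r) = c • (volume : Measure (ℝ × ℝ)) := by
  let L : ℝ × ℝ →ₗ[ℝ] E3 :=
    { toFun := fun p => pt ![p.1 + p.2 * r / 3, - p.1 - p.2 + p.2 * r / 3, p.2 * r / 3]
      map_add' := fun p q => by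
        ext i
        fin_cases i <;> simp [pt] <;> ring
      map_smul' := fun c p => by
        ext i
        fin_cases i <;> simp [pt] <;> ring }
  have hL : Function.Injective L := by
    refine (injective_iff_map_eq_zero L).2 fun p hp => ?_
    have h0 : p.1 + p.2 * r / 3 = 0 := congrArg (· 0) hp
    have h2 : p.2 * r / 3 = 0 := congrArg (· 2) hp
    have : p.2 = 0 := by simpa [hr.ne'] using h2
    ext
    · simpa [this] using h0
    · exact this
  have h : facePoint r = fun p => pt ![0, 1, 0] + L p := by
    funext p
    ext i
    fin_cases i <;> simp [pt, facePoint, L]; ring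
  rw [h]
  exact exists_comap_hausdorffMeasure_eq_smul L hL _

theorem facePoint_injective (hr : 0 < r) : Function.Injective (facePoint r) := by
  intro p q h
  have h0 : p.1 + p.2 * r / 3 = q.1 + q.2 * r / 3 := congrArg (· 0) h
  have h2 : p.2 * r / 3 = q.2 * r / 3 := congrArg (· 2) h
  have : p.2 = q.2 := by
    field_simp at h2
    exact h2
  ext
  · linarith
  · exact this

theorem measurableEmbedding_facePoint (hr : 0 < r) : MeasurableEmbedding (facePoint r) :=
  (continuous_facePoint r).measurableEmbedding (facePoint_injective hr)

theorem image_facePoint_simplex (r : ℝ) :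
    facePoint r '' simplex = convexHull ℝ {vA true, vB true, vD r true true true} := by
  refine Set.Subset.antisymm ?_ ?_
  · rintro _ ⟨p, hp, rfl⟩
    rw [mem_simplex] at hp
    have hA : vA true ∈ convexHull ℝ {vA true, vB true, vD r true true true} :=
      subset_convexHull _ _ (by simp)
    have hB : vB true ∈ convexHull ℝ {vA true, vB true, vD r true true true} :=
      subset_convexHull _ _ (by simp)
    have hD : vD r true true true ∈ convexHull ℝ {vA true, vB true, vD r true true true} :=
      subset_convexHull _ _ (by simp)
    have h := (convex_convexHull ℝ {vA true, vB true, vD r true true true}).sum_mem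
      (t := Finset.univ) (w := ![p.1, 1 - p.1 - p.2, p.2])
      (z := ![vA true, vB true, vD r true true true])
      (by intro i _; fin_cases i <;> simp <;> linarith) (by simp [Fin.sum_univ_three]; ring)
      (by intro i _; fin_cases i <;> simpa)
    convert! h
    rw [Fin.sum_univ_three]
    ext i
    fin_cases i <;> simp [facePoint, vA, vB, vD, pt, sg] <;> ring
  · refine convexHull_min ?_ ?_
    · rintro _ (rfl | rfl | rfl)
      · refine ⟨(1, 0), mem_simplex.2 (by norm_num), ?_⟩
        ext i
        fin_cases i <;> simp [facePoint, vA, pt, sg]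
      · refine ⟨(0, 0), mem_simplex.2 (by norm_num), ?_⟩
        ext i
        fin_cases i <;> simp [facePoint, vB, pt, sg]
      · refine ⟨(0, 1), mem_simplex.2 (by norm_num), ?_⟩
        ext i
        fin_cases i <;> simp [facePoint, vD, pt, sg]
    · rintro _ ⟨p, hp, rfl⟩ _ ⟨q, hq, rfl⟩ a b ha hb hab
      refine ⟨a • p + b • q, convex_simplex hp hq ha hb hab, ?_⟩
      obtain rfl : a = 1 - b := by linarith
      ext i
      fin_cases i <;> simp [facePoint, pt] <;> ring

theorem mem_image_facePoint (hr : 0 < r) {x : E3} : x ∈ facePoint r '' simplex ↔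
    0 ≤ x 2 ∧ x 2 ≤ x 0 ∧ x 2 ≤ x 1 ∧ x 0 + x 1 + (3 / r - 2) * x 2 = 1 := by
  constructor
  · rintro ⟨p, hp, rfl⟩
    rw [mem_simplex] at hp
    have : 0 ≤ p.2 * r / 3 := by have := hp.2.1; positivity
    simp only [facePoint, pt, WithLp.equiv_symm_apply, Matrix.cons_val]
    refine ⟨this, by linarith, by linarith, ?_⟩
    field_simp
    ring
  · rintro ⟨h0, h1, h2, h⟩
    have h3 : 3 / r * x 2 = 3 * x 2 / r := by ring
    refine ⟨(x 0 - x 2, 3 * x 2 / r), mem_simplex.2 ⟨by simpa, by positivity, ?_⟩, ?_⟩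
    · simp only
      linarith
    · have h4 : 3 * x 2 / r * r / 3 = x 2 := by field_simp
      ext i
      fin_cases i
      · simp [facePoint, pt, h4]
      · simp [facePoint, pt, h4]
        linarith
      · simp [facePoint, pt, h4]

/-- The isometries of the octahedron that carry one face of the triakis octahedron to each of the
faces. -/
noncomputable def faceIsometry (g : (Fin 3 → Bool) × Fin 3) : E3 ≃ₗᵢ[ℝ] E3 :=
  signedPerm g.1 (Equiv.swap g.2 2)

theorem faceSet_eq_iUnion (r : ℝ) :
    faceSet r = ⋃ g, faceIsometry g '' (facePoint r '' simplex) := by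
  have himage (g : (Fin 3 → Bool) × Fin 3) : faceIsometry g '' (facePoint r '' simplex) =
      convexHull ℝ {faceIsometry g (vA true), faceIsometry g (vB true),
        faceIsometry g (vD r true true true)} := by
    rw [image_facePoint_simplex]
    have := (faceIsometry g).toLinearEquiv.toLinearMap.image_convexHull
      {vA true, vB true, vD r true true true}
    rw [Set.image_insert_eq, Set.image_pair] at this
    exact this
  have hsg : sg true = 1 := rfl
  have h10 : Equiv.swap (1 : Fin 3) 2 0 = 0 := by decide
  have h01 : Equiv.swap (0 : Fin 3) 2 1 = 1 := by decide
  have h2 (a b c : Bool) : faceIsometry (![a, b, c], 2) '' (facePoint r '' simplex) =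
      convexHull ℝ {vA a, vB b, vD r a b c} := by
    rw [himage]
    refine congrArg (convexHull ℝ) (congrArg₂ insert ?_ (congrArg₂ insert ?_
      (congrArg singleton ?_))) <;> ext i <;> rw [faceIsometry, signedPerm_apply] <;>
      fin_cases i <;> simp [vA, vB, vD, pt, hsg, mul_div_assoc]
  have h1 (a b c : Bool) : faceIsometry (![a, b, c], 1) '' (facePoint r '' simplex) =
      convexHull ℝ {vA a, vC c, vD r a b c} := by
    rw [himage]
    refine congrArg (convexHull ℝ) (congrArg₂ insert ?_ (congrArg₂ insert ?_
      (congrArg singleton ?_))) <;> ext i <;> rw [faceIsometry, signedPerm_apply] <;>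
      fin_cases i <;> simp [vA, vB, vC, vD, pt, hsg, h10, mul_div_assoc]
  have h0 (a b c : Bool) : faceIsometry (![a, b, c], 0) '' (facePoint r '' simplex) =
      convexHull ℝ {vB b, vC c, vD r a b c} := by
    rw [himage, Set.insert_comm]
    refine congrArg (convexHull ℝ) (congrArg₂ insert ?_ (congrArg₂ insert ?_
      (congrArg singleton ?_))) <;> ext i <;> rw [faceIsometry, signedPerm_apply] <;>
      fin_cases i <;> simp [vA, vB, vC, vD, pt, hsg, h01, mul_div_assoc]
  ext x
  simp only [faceSet, Set.mem_iUnion, Set.mem_union, ← h0, ← h1, ← h2]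
  constructor
  · rintro ⟨a, b, c, (h | h) | h⟩
    exacts [⟨_, h⟩, ⟨_, h⟩, ⟨_, h⟩]
  · rintro ⟨⟨ε, k⟩, h⟩
    refine ⟨ε 0, ε 1, ε 2, ?_⟩
    have : ![ε 0, ε 1, ε 2] = ε := by ext i; fin_cases i <;> rfl
    rw [this]
    fin_cases k
    exacts [Or.inr h, Or.inl (Or.inr h), Or.inl (Or.inl h)]

theorem faceIsometry_apply (g : (Fin 3 → Bool) × Fin 3) (x : E3) (i : Fin 3) :
    faceIsometry g x i = sg (g.1 i) * x (Equiv.swap g.2 2 i) :=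
  signedPerm_apply ..

theorem abs_sg_mul (b : Bool) (t : ℝ) : |sg b * t| = |t| := by
  cases b <;> simp [sg]

theorem mem_image_faceIsometry (hr : 0 < r) {g : (Fin 3 → Bool) × Fin 3} {x : E3}
    (hx : x ∈ faceIsometry g '' (facePoint r '' simplex)) :
    (∀ i, |x g.2| ≤ |x i|) ∧ ∑ i, |x i| + (3 / r - 3) * |x g.2| = 1 := by
  obtain ⟨y, hy, rfl⟩ := hx
  rw [mem_image_facePoint hr] at hy
  obtain ⟨h2, h20, h21, h⟩ := hy
  simp only [faceIsometry_apply, abs_sg_mul, Equiv.swap_apply_left]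
  rw [Equiv.sum_comp (Equiv.swap g.2 2) fun i => |y i|, Fin.sum_univ_three, abs_of_nonneg h2,
    abs_of_nonneg (h2.trans h20), abs_of_nonneg (h2.trans h21)]
  refine ⟨fun i => ?_, by linarith⟩
  generalize Equiv.swap g.2 2 i = j
  refine le_trans ?_ (le_abs_self _)
  fin_cases j
  exacts [h20, h21, le_rfl]

theorem mem_faceSet (hr : 0 < r) {x : E3} : x ∈ faceSet r ↔
    ∃ k, (∀ i, |x k| ≤ |x i|) ∧ ∑ i, |x i| + (3 / r - 3) * |x k| = 1 := by
  rw [faceSet_eq_iUnion, Set.mem_iUnion]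
  constructor
  · rintro ⟨g, hg⟩
    exact ⟨g.2, mem_image_faceIsometry hr hg⟩
  · rintro ⟨k, hk, h⟩
    refine ⟨(fun i => decide (0 ≤ x i), k),
      pt fun i => |x (Equiv.swap k 2 i)|, (mem_image_facePoint hr).2 ?_, ?_⟩
    · rw [← Equiv.sum_comp (Equiv.swap k 2), Fin.sum_univ_three] at h
      simp only [pt, WithLp.equiv_symm_apply, Equiv.swap_apply_right] at h ⊢
      exact ⟨abs_nonneg _, hk _, hk _, by linarith⟩
    · ext i
      rw [faceIsometry_apply]
      by_cases hi : 0 ≤ x i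
      · simp [pt, sg, hi, abs_of_nonneg hi]
      · simp [pt, sg, hi, abs_of_neg (not_le.1 hi)]

theorem isCompact_faceSet (r : ℝ) : IsCompact (faceSet r) := by
  rw [faceSet_eq_iUnion]
  exact isCompact_iUnion fun g => (isCompact_simplex.image (continuous_facePoint r)).image
    (faceIsometry g).continuous

theorem isOctahedral_faceSet (hr : 0 < r) :
    IsOctahedral ((μH[2] : Measure E3).restrict (faceSet r)) := by
  intro ε σ
  have hpre : signedPerm ε σ ⁻¹' faceSet r = faceSet r := by
    ext x
    rw [Set.mem_preimage, mem_faceSet hr, mem_faceSet hr]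
    simp only [signedPerm_apply, abs_sg_mul]
    refine σ.exists_congr fun k => ?_
    rw [Equiv.sum_comp σ fun i => |x i|, σ.forall_congr_left]
    simp
  have h :=
    ((signedPerm ε σ).toIsometryEquiv.measurePreserving_hausdorffMeasure 2).restrict_preimage
    (isCompact_faceSet r).measurableSet
  rwa [show (signedPerm ε σ).toIsometryEquiv ⁻¹' faceSet r = faceSet r from hpre] at h

theorem eq_of_facePoint_mem_openSimplex (hr : 0 < r) {g g' : (Fin 3 → Bool) × Fin 3} {p : ℝ × ℝ}
    (hp : p ∈ openSimplex)
    (h : faceIsometry g (facePoint r p) ∈ faceIsometry g' '' (facePoint r '' simplex)) :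
    g = g' := by
  rw [mem_openSimplex] at hp
  have hpos : 0 < p.2 * r / 3 := by have := hp.2.1; positivity
  obtain ⟨y, hy, hyx⟩ := h
  have hk := (mem_image_faceIsometry hr ⟨y, hy, hyx⟩).1
  simp only [faceIsometry_apply, abs_sg_mul] at hk
  have hlt (j : Fin 3) (hj : j ≠ 2) : facePoint r p 2 < facePoint r p j := by
    fin_cases j
    · simpa [facePoint, pt] using hp.1
    · simp [facePoint, pt]
      linarith
    · exact absurd rfl hj
  have hpos' (j : Fin 3) : 0 < facePoint r p j := by
    have h2 : 0 < facePoint r p 2 := hpos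
    by_cases hj : j = 2
    · rwa [hj]
    · exact h2.trans (hlt j hj)
  have h2 : g.2 = g'.2 := by
    by_contra hne
    have := hk g.2
    rw [abs_of_pos (hpos' _), abs_of_pos (hpos' _), Equiv.swap_apply_left] at this
    refine this.not_gt (hlt _ fun h => hne ?_)
    rw [Equiv.swap_apply_eq_iff, Equiv.swap_apply_right] at h
    exact h.symm
  refine Prod.ext (funext fun i => ?_) h2
  have h := congrArg (fun z : E3 => z i) hyx
  simp only [faceIsometry_apply, h2] at h
  have hy0 : 0 ≤ y (Equiv.swap g'.2 2 i) := by
    rw [mem_image_facePoint hr] at hy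
    generalize Equiv.swap g'.2 2 i = j
    fin_cases j
    exacts [hy.1.trans hy.2.1, hy.1.trans hy.2.2.1, hy.1]
  have := hpos' (Equiv.swap g'.2 2 i)
  cases hg : g.1 i <;> cases hg' : g'.1 i <;> simp [sg, hg, hg'] at h ⊢ <;> linarith

theorem hausdorffMeasure_image_faceIsometry (g : (Fin 3 → Bool) × Fin 3) (s : Set E3) :
    μH[2] (faceIsometry g '' s) = μH[2] s :=
  (faceIsometry g).toIsometryEquiv.hausdorffMeasure_image 2 s

theorem hausdorffMeasure_faceSet_lt_top (hr : 0 < r) : μH[2] (faceSet r) < ⊤ := by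
  obtain ⟨c, -, hcomap⟩ := exists_comap_facePoint hr
  rw [faceSet_eq_iUnion]
  refine (measure_iUnion_le _).trans_lt ?_
  rw [tsum_fintype]
  refine ENNReal.sum_lt_top.2 fun g _ => ?_
  rw [hausdorffMeasure_image_faceIsometry, ← (measurableEmbedding_facePoint hr).comap_apply, hcomap]
  exact ENNReal.mul_lt_top (by simp) isCompact_simplex.measure_lt_top

theorem exists_integral_faceSet (hr : 0 < r) : ∃ c : ℝ, 0 < c ∧ ∀ q : E3 → ℝ, Continuous q →
    ∫ y in faceSet r, q y ∂μH[2] =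
      c * ∑ g, ∫ p in simplex, q (faceIsometry g (facePoint r p)) := by
  obtain ⟨c, hc, hcomap⟩ := exists_comap_facePoint hr
  have hemb := measurableEmbedding_facePoint hr
  have hfacePoint (s : Set (ℝ × ℝ)) : μH[2] (facePoint r '' s) = c * volume s := by
    rw [← hemb.comap_apply, hcomap]
    rfl
  have hmeas (g) : MeasurableSet (faceIsometry g '' (facePoint r '' simplex)) :=
    ((isCompact_simplex.image (continuous_facePoint r)).image
      (faceIsometry g).continuous).measurableSet
  refine ⟨c, by positivity, fun q hq => ?_⟩
  have hint : IntegrableOn q (faceSet r) μH[2] :=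
    hq.continuousOn.integrableOn_of_subset_isCompact (isCompact_faceSet r)
      (isCompact_faceSet r).measurableSet subset_rfl (hausdorffMeasure_faceSet_lt_top hr).ne
  rw [faceSet_eq_iUnion] at hint ⊢
  rw [integral_iUnion_ae (fun g => (hmeas g).nullMeasurableSet) ?_ hint, tsum_fintype,
    Finset.mul_sum]
  · refine Finset.sum_congr rfl fun g _ => ?_
    have h1 := ((faceIsometry g).toIsometryEquiv.measurePreserving_hausdorffMeasure
      2).setIntegral_image_emb (faceIsometry g).toHomeomorph.measurableEmbedding q
      (facePoint r '' simplex)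
    have h2 : MeasurePreserving (facePoint r) ((μH[2] : Measure E3).comap (facePoint r))
        ((μH[2] : Measure E3).restrict (Set.range (facePoint r))) :=
      ⟨hemb.measurable, hemb.map_comap _⟩
    have h3 := h2.setIntegral_image_emb hemb (fun y => q (faceIsometry g y)) simplex
    rw [Measure.restrict_restrict_of_subset (Set.image_subset_range _ _), hcomap,
      Measure.restrict_smul, integral_smul_nnreal_measure] at h3
    exact h1.trans h3
  · intro g g' hne
    refine measure_mono_null (t := faceIsometry g '' (facePoint r '' (simplex \ openSimplex))) ?_ ?_
    · rintro _ ⟨⟨_, ⟨p, hp, rfl⟩, rfl⟩, hx⟩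
      exact ⟨_, ⟨p, ⟨hp, fun hp' => hne (eq_of_facePoint_mem_openSimplex hr hp' hx)⟩, rfl⟩, rfl⟩
    · rw [hausdorffMeasure_image_faceIsometry, hfacePoint, volume_simplex_diff_openSimplex,
        mul_zero]

end

theorem sum_piAntidiag_fin_three {M : Type*} [AddCommMonoid M] (n : ℕ) (F : (Fin 3 → ℕ) → M) :
    ∑ β ∈ Finset.piAntidiag Finset.univ n, F β =
      ∑ p ∈ Finset.HasAntidiagonal.antidiagonal n,
        ∑ q ∈ Finset.HasAntidiagonal.antidiagonal p.2, F ![p.1, q.1, q.2] := by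
  rw [Finset.sum_sigma']
  refine Finset.sum_nbij' (fun β => ⟨(β 0, β 1 + β 2), (β 1, β 2)⟩)
    (fun s => ![s.1.1, s.2.1, s.2.2]) ?_ ?_ ?_ ?_ ?_
  · intro β hβ
    simp [Fin.sum_univ_three] at hβ ⊢
    omega
  · intro s hs
    simp [Fin.sum_univ_three] at hs ⊢
    omega
  · intro β _
    ext i; fin_cases i <;> rfl
  · rintro ⟨⟨a, b⟩, ⟨c, d⟩⟩ hs
    simp at hs ⊢
    exact hs.2
  · intro β _
    congr 1
    ext i; fin_cases i <;> rfl

theorem eval_evenMomentPoly {ν : Measure E3} {K : Set E3} (hK : IsCompact K) [IsFiniteMeasure ν]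
    (hν : ν Kᶜ = 0) (u : Fin 3 → ℝ) (n : ℕ) :
    eval u (evenMomentPoly ν n) = ∫ y, ∑ p ∈ Finset.HasAntidiagonal.antidiagonal n,
      ∑ q ∈ Finset.HasAntidiagonal.antidiagonal p.2,
        (Nat.multinomial Finset.univ ![2 * p.1, 2 * q.1, 2 * q.2] : ℝ) *
          (y 0 ^ (2 * p.1) * y 1 ^ (2 * q.1) * y 2 ^ (2 * q.2)) *
          (u 0 ^ p.1 * u 1 ^ q.1 * u 2 ^ q.2) ∂ν := by
  rw [integral_finsetSum _ fun p _ => integrable_of_continuous hK hν (by fun_prop),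
    evenMomentPoly, sum_piAntidiag_fin_three, map_sum]
  refine Finset.sum_congr rfl fun p _ => ?_
  rw [integral_finsetSum _ fun q _ => integrable_of_continuous hK hν (by fun_prop), map_sum]
  refine Finset.sum_congr rfl fun q _ => ?_
  rw [integral_mul_const, integral_const_mul, evenMomentCoeff]
  have : 2 • ![p.1, q.1, q.2] = ![2 * p.1, 2 * q.1, 2 * q.2] := by
    ext i; fin_cases i <;> simp
  simp only [this, map_mul, eval_C, map_pow, eval_X, Fin.prod_univ_three]
  simp

theorem integral_pow_mul_sub_pow (c : ℝ) (d b : ℕ) : ∫ t in (0 : ℝ)..c, t ^ d * (c - t) ^ b =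
    d.factorial * b.factorial / (d + b + 1).factorial * c ^ (d + b + 1) := by
  induction b generalizing d with
  | zero =>
    simp only [pow_zero, mul_one, integral_pow, Nat.factorial_succ, Nat.factorial_zero, add_zero]
    push_cast
    field_simp
    simp
  | succ b ih =>
    have hderiv (t : ℝ) : HasDerivAt (fun t => t ^ (d + 1) * (c - t) ^ (b + 1))
        ((d + 1) * (t ^ d * (c - t) ^ (b + 1)) - (b + 1) * (t ^ (d + 1) * (c - t) ^ b)) t := by
      have h1 := (hasDerivAt_id t).pow (d + 1)
      have h2 := ((hasDerivAt_id t).const_sub c).pow (b + 1)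
      convert! h1.mul h2 using 1
      simp
      ring
    have h := intervalIntegral.integral_eq_sub_of_hasDerivAt (fun t _ => hderiv t)
      ((by fun_prop : Continuous _).intervalIntegrable 0 c)
    rw [intervalIntegral.integral_sub ((by fun_prop : Continuous _).intervalIntegrable 0 c)
      ((by fun_prop : Continuous _).intervalIntegrable 0 c),
      intervalIntegral.integral_const_mul, intervalIntegral.integral_const_mul, ih] at h
    have hfac : ((d + 1 + b + 1).factorial : ℝ) ≠ 0 := by positivity
    have e : d + (b + 1) + 1 = d + 1 + b + 1 := by ring
    rw [e]
    have hd : (d + 1 : ℝ) ≠ 0 := by positivity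
    apply mul_left_cancel₀ hd
    simp only [sub_self, zero_pow (Nat.succ_ne_zero _), mul_zero, zero_mul, sub_zero,
      sub_eq_zero] at h
    rw [h, Nat.factorial_succ b, Nat.factorial_succ d]
    push_cast
    ring

theorem integrableOn_simplex {f : ℝ × ℝ → ℝ} (hf : Continuous f) :
    IntegrableOn f simplex :=
  hf.continuousOn.integrableOn_compact isCompact_simplex

theorem integral_simplex {f : ℝ × ℝ → ℝ} (hf : Continuous f) :
    ∫ p in simplex, f p = ∫ s in (0 : ℝ)..1, ∫ t in (0 : ℝ)..(1 - s), f (s, t) := by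
  have hm := isClosed_simplex.measurableSet
  rw [← integral_indicator hm, Measure.volume_eq_prod, integral_prod _
    ((integrable_indicator_iff hm).2 (integrableOn_simplex hf)),
    intervalIntegral.integral_of_le zero_le_one, ← integral_Icc_eq_integral_Ioc,
    ← integral_indicator measurableSet_Icc]
  congr 1 with s
  by_cases hs : s ∈ Set.Icc (0 : ℝ) 1
  · rw [Set.indicator_of_mem hs, intervalIntegral.integral_of_le (by linarith [hs.2]),
      ← integral_Icc_eq_integral_Ioc, ← integral_indicator measurableSet_Icc]
    congr 1 with t
    simp only [Set.indicator, mem_simplex, Set.mem_Icc]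
    refine if_congr ⟨fun h => ⟨h.2.1, by linarith [h.2.2]⟩,
      fun h => ⟨hs.1, h.1, by linarith [h.2]⟩⟩ rfl rfl
  · rw [Set.indicator_of_notMem hs]
    refine integral_eq_zero_of_ae (.of_forall fun t => Set.indicator_of_notMem (fun h => hs ?_) _)
    rw [mem_simplex] at h
    exact ⟨h.1, by linarith [h.2.1, h.2.2]⟩

theorem integral_simplex_monomial (a b d : ℕ) :
    ∫ p in simplex, p.1 ^ a * (1 - p.1 - p.2) ^ b * p.2 ^ d =
      a.factorial * b.factorial * d.factorial / (a + b + d + 2).factorial := by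
  rw [integral_simplex (by fun_prop)]
  have h (s : ℝ) : ∫ t in (0 : ℝ)..(1 - s), s ^ a * (1 - s - t) ^ b * t ^ d =
      d.factorial * b.factorial / (d + b + 1).factorial * (s ^ a * (1 - s) ^ (d + b + 1)) := by
    rw [← mul_left_comm, ← integral_pow_mul_sub_pow, ← intervalIntegral.integral_const_mul]
    congr 1 with t
    ring
  simp only [h]
  rw [intervalIntegral.integral_const_mul, integral_pow_mul_sub_pow]
  have h1 : ((d + b + 1).factorial : ℝ) ≠ 0 := by positivity
  rw [show a + (d + b + 1) + 1 = a + b + d + 2 by ring]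
  field_simp
  simp

/-- A polynomial in the barycentric coordinates of a point of the simplex, given by the list of its
coefficients and exponents. -/
def barycentricPoly (l : List (ℝ × ℕ × ℕ × ℕ)) (p : ℝ × ℝ) : ℝ :=
  (l.map fun m => m.1 * (p.1 ^ m.2.1 * (1 - p.1 - p.2) ^ m.2.2.1 * p.2 ^ m.2.2.2)).sum

theorem continuous_barycentricPoly (l : List (ℝ × ℕ × ℕ × ℕ)) :
    Continuous (barycentricPoly l) := by
  unfold barycentricPoly
  induction l with
  | nil => exact continuous_const
  | cons m l ih =>
    simp only [List.map_cons, List.sum_cons]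
    fun_prop

theorem integral_barycentricPoly (l : List (ℝ × ℕ × ℕ × ℕ)) :
    ∫ p in simplex, barycentricPoly l p =
      (l.map fun m => m.1 * ((m.2.1.factorial * m.2.2.1.factorial * m.2.2.2.factorial : ℝ) /
        (m.2.1 + m.2.2.1 + m.2.2.2 + 2).factorial)).sum := by
  induction l with
  | nil => simp [barycentricPoly]
  | cons m l ih =>
    rw [List.map_cons, List.sum_cons, ← ih, ← integral_simplex_monomial, ← integral_const_mul,
      ← integral_add (integrableOn_simplex (by fun_prop))
        (integrableOn_simplex (continuous_barycentricPoly l))]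
    simp only [barycentricPoly, List.map_cons, List.sum_cons]

theorem exists_integral_faceSet_sq {r : ℝ} (hr : 0 < r) : ∃ c : ℝ, 0 < c ∧
    ∀ H : ℝ → ℝ → ℝ → ℝ, (Continuous fun y : E3 => H (y 0 ^ 2) (y 1 ^ 2) (y 2 ^ 2)) →
      ∀ l, (∀ α β t : ℝ, 1 - α - t = β → ∀ a b d, (α + t * r / 3) ^ 2 = a →
        (β + t * r / 3) ^ 2 = b → (t * r / 3) ^ 2 = d →
        H a b d + H a d b + H d b a = barycentricPoly l (α, t)) →
      ∫ y in faceSet r, H (y 0 ^ 2) (y 1 ^ 2) (y 2 ^ 2) ∂μH[2] =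
        c * ∫ p in simplex, barycentricPoly l p := by
  obtain ⟨c, hc, h⟩ := exists_integral_faceSet hr
  refine ⟨8 * c, by positivity, fun H hH l hl => ?_⟩
  have hsq (g : (Fin 3 → Bool) × Fin 3) (x : E3) (i : Fin 3) :
      faceIsometry g x i ^ 2 = x (Equiv.swap g.2 2 i) ^ 2 := by
    rw [faceIsometry_apply, ← sq_abs, abs_sg_mul, sq_abs]
  have hint (k : Fin 3) : IntegrableOn (fun p => H (facePoint r p (Equiv.swap k 2 0) ^ 2)
      (facePoint r p (Equiv.swap k 2 1) ^ 2) (facePoint r p (Equiv.swap k 2 2) ^ 2)) simplex := by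
    refine integrableOn_simplex ?_
    have := hH.comp ((faceIsometry (fun _ => true, k)).continuous.comp (continuous_facePoint r))
    simpa only [Function.comp_def, hsq] using this
  rw [h _ hH, Fintype.sum_prod_type]
  simp only [hsq, Finset.sum_const, Finset.card_univ, Fintype.card_pi, Fintype.card_bool,
    Finset.prod_const, Fintype.card_fin]
  rw [← integral_finsetSum _ fun k _ => hint k]
  have hb (p : ℝ × ℝ) : ∑ k, H (facePoint r p (Equiv.swap k 2 0) ^ 2)
      (facePoint r p (Equiv.swap k 2 1) ^ 2) (facePoint r p (Equiv.swap k 2 2) ^ 2) =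
      barycentricPoly l p := by
    rw [← hl p.1 (1 - p.1 - p.2) p.2 rfl _ _ _ rfl rfl rfl, Fin.sum_univ_three]
    have h10 : Equiv.swap (1 : Fin 3) 2 0 = 0 := by decide
    have h01 : Equiv.swap (0 : Fin 3) 2 1 = 1 := by decide
    simp only [Equiv.swap_apply_left, Equiv.swap_apply_right, Equiv.swap_self, Equiv.refl_apply,
      h10, h01, facePoint, pt, WithLp.equiv_symm_apply, Matrix.cons_val]
    ring
  simp only [hb]
  ring

theorem isFiniteMeasure_restrict_faceSet {r : ℝ} (hr : 0 < r) :
    IsFiniteMeasure ((μH[2] : Measure E3).restrict (faceSet r)) :=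
  ⟨by simpa using hausdorffMeasure_faceSet_lt_top hr⟩

theorem restrict_faceSet_compl (r : ℝ) :
    (μH[2] : Measure E3).restrict (faceSet r) (faceSet r)ᶜ = 0 := by
  rw [Measure.restrict_apply (isCompact_faceSet r).measurableSet.compl, Set.compl_inter_self,
    measure_empty]

set_option maxHeartbeats 1000000 in
theorem eval_evenMomentPoly_faceSet {r : ℝ} (hr : 0 < r) : ∃ V : ℝ, 0 < V ∧
    (μH[2] (faceSet r)).toReal = V ∧
    eval ![1, 0, 0] (evenMomentPoly (μH[2].restrict (faceSet r)) 1) =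
      V * ((r ^ 2 + 2 * r + 6) / 54) ∧
    eval ![1, -1, 0] (evenMomentPoly (μH[2].restrict (faceSet r)) 2) =
      -V * ((4 * r ^ 4 + 8 * r ^ 3 + 6 * r ^ 2 - 18 * r - 81) / 1215) ∧
    eval ![1, 1, -2] (evenMomentPoly (μH[2].restrict (faceSet r)) 3) =
      -V * ((16 * r ^ 6 + 32 * r ^ 5 + 24 * r ^ 4 - 18 * r ^ 3 - 54 * r ^ 2 + 243) / 3402) ∧
    eval ![1, -1, 0] (evenMomentPoly (μH[2].restrict (faceSet r)) 4) =
      V * ((4 * r ^ 4 * (4 * r ^ 4 + 8 * r ^ 3 + 6 * r ^ 2 - 18 * r - 81) -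
          81 * (4 * r ^ 4 + 8 * r ^ 3 + 6 * r ^ 2 - 18 * r - 81) + 324 * r ^ 4) / 295245) := by
  obtain ⟨c, hc, h⟩ := exists_integral_faceSet_sq hr
  have hK := isCompact_faceSet r
  have := isFiniteMeasure_restrict_faceSet hr
  have hν := restrict_faceSet_compl r
  have h0 := h (fun _ _ _ => 1) continuous_const [(3, 0, 0, 0)] (by
    intros
    norm_num [barycentricPoly])
  have h1 := h (fun a _ _ => a)
      (by fun_prop)
      [(3 * (r / 3) ^ 2, 0, 0, 2), (4 * (r / 3), 1, 0, 1), (2, 2, 0, 0)] (by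
    rintro α β t hβ _ _ _ rfl rfl rfl
    simp only [barycentricPoly, List.map_cons, List.map_nil, List.sum_cons, List.sum_nil, hβ]
    ring)
  have h2 := h (fun a b _ => a ^ 2 - 6 * a * b + b ^ 2)
      (by fun_prop)
      [(-12 * (r / 3) ^ 4, 0, 0, 4), (-16 * (r / 3) ^ 3, 0, 1, 3), (8 * (r / 3), 0, 3, 1),
       (2, 0, 4, 0), (-16 * (r / 3) ^ 3, 1, 0, 3), (-24 * (r / 3) ^ 2, 1, 1, 2),
       (-12 * (r / 3), 1, 2, 1), (-12 * (r / 3), 2, 1, 1), (-6, 2, 2, 0), (8 * (r / 3), 3, 0, 1),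
       (2, 4, 0, 0)] (by
    rintro α β t hβ _ _ _ rfl rfl rfl
    simp only [barycentricPoly, List.map_cons, List.map_nil, List.sum_cons, List.sum_nil, hβ]
    ring)
  have h3 := h (fun a b d => a ^ 3 + 15 * a ^ 2 * b - 30 * a ^ 2 * d + 15 * a * b ^ 2 -
      180 * a * b * d + 60 * a * d ^ 2 + b ^ 3 - 30 * b ^ 2 * d + 60 * b * d ^ 2 - 8 * d ^ 3)
      (by fun_prop)
      [(-288 * (r / 3) ^ 6, 0, 0, 6), (-576 * (r / 3) ^ 5, 0, 1, 5),
       (240 * (r / 3) ^ 3, 0, 3, 3), (-36 * (r / 3), 0, 5, 1), (-6, 0, 6, 0),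
       (-576 * (r / 3) ^ 5, 1, 0, 5), (-1440 * (r / 3) ^ 4, 1, 1, 4),
       (-360 * (r / 3) ^ 3, 1, 2, 3), (360 * (r / 3) ^ 2, 1, 3, 2), (90 * (r / 3), 1, 4, 1),
       (-360 * (r / 3) ^ 3, 2, 1, 3), (180 * (r / 3), 2, 3, 1), (45, 2, 4, 0),
       (240 * (r / 3) ^ 3, 3, 0, 3), (360 * (r / 3) ^ 2, 3, 1, 2), (180 * (r / 3), 3, 2, 1),
       (90 * (r / 3), 4, 1, 1), (45, 4, 2, 0), (-36 * (r / 3), 5, 0, 1), (-6, 6, 0, 0)] (by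
    rintro α β t hβ _ _ _ rfl rfl rfl
    simp only [barycentricPoly, List.map_cons, List.map_nil, List.sum_cons, List.sum_nil, hβ]
    ring)
  have h4 := h (fun a b _ => a ^ 4 - 28 * a ^ 3 * b + 70 * a ^ 2 * b ^ 2 - 28 * a * b ^ 3 + b ^ 4)
      (by fun_prop)
      [(48 * (r / 3) ^ 8, 0, 0, 8), (128 * (r / 3) ^ 7, 0, 1, 7), (-448 * (r / 3) ^ 5, 0, 3, 5),
       (-560 * (r / 3) ^ 4, 0, 4, 4), (-224 * (r / 3) ^ 3, 0, 5, 3), (16 * (r / 3), 0, 7, 1),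
       (2, 0, 8, 0), (128 * (r / 3) ^ 7, 1, 0, 7), (448 * (r / 3) ^ 6, 1, 1, 6),
       (672 * (r / 3) ^ 5, 1, 2, 5), (-560 * (r / 3) ^ 3, 1, 4, 3),
       (-336 * (r / 3) ^ 2, 1, 5, 2), (-56 * (r / 3), 1, 6, 1), (672 * (r / 3) ^ 5, 2, 1, 5),
       (1680 * (r / 3) ^ 4, 2, 2, 4), (1120 * (r / 3) ^ 3, 2, 3, 3), (-168 * (r / 3), 2, 5, 1),
       (-28, 2, 6, 0), (-448 * (r / 3) ^ 5, 3, 0, 5), (1120 * (r / 3) ^ 3, 3, 2, 3),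
       (1120 * (r / 3) ^ 2, 3, 3, 2), (280 * (r / 3), 3, 4, 1), (-560 * (r / 3) ^ 4, 4, 0, 4),
       (-560 * (r / 3) ^ 3, 4, 1, 3), (280 * (r / 3), 4, 3, 1), (70, 4, 4, 0),
       (-224 * (r / 3) ^ 3, 5, 0, 3), (-336 * (r / 3) ^ 2, 5, 1, 2), (-168 * (r / 3), 5, 2, 1),
       (-56 * (r / 3), 6, 1, 1), (-28, 6, 2, 0), (16 * (r / 3), 7, 0, 1), (2, 8, 0, 0)] (by
    rintro α β t hβ _ _ _ rfl rfl rfl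
    simp only [barycentricPoly, List.map_cons, List.map_nil, List.sum_cons, List.sum_nil, hβ]
    ring)
  rw [integral_barycentricPoly] at h0 h1 h2 h3 h4
  simp only [List.map_cons, List.map_nil, List.sum_cons, List.sum_nil, Nat.factorial,
    integral_const, measureReal_restrict_apply_univ, smul_eq_mul, mul_one] at h0 h1 h2 h3 h4
  refine ⟨c * 3 / 2, by positivity, ?_, ?_, ?_, ?_, ?_⟩
  · rw [← measureReal_def, h0]
    norm_num
    ring
  · rw [eval_evenMomentPoly hK hν]
    refine (integral_congr_ae (.of_forall fun y => ?_)).trans (h1.trans ?_)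
    · simp [Finset.Nat.antidiagonal_succ, Nat.multinomial, Fin.sum_univ_three, Fin.prod_univ_three,
        Nat.factorial]
    · norm_num
      ring
  · rw [eval_evenMomentPoly hK hν]
    refine (integral_congr_ae (.of_forall fun y => ?_)).trans (h2.trans ?_)
    · simp [Finset.Nat.antidiagonal_succ, Nat.multinomial, Fin.sum_univ_three, Fin.prod_univ_three,
        Nat.factorial]
      ring
    · norm_num
      ring
  · rw [eval_evenMomentPoly hK hν]
    refine (integral_congr_ae (.of_forall fun y => ?_)).trans (h3.trans ?_)
    · simp [Finset.Nat.antidiagonal_succ, Nat.multinomial, Fin.sum_univ_three, Fin.prod_univ_three,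
        Nat.factorial]
      ring
    · norm_num
      ring
  · rw [eval_evenMomentPoly hK hν]
    refine (integral_congr_ae (.of_forall fun y => ?_)).trans (h4.trans ?_)
    · simp [Finset.Nat.antidiagonal_succ, Nat.multinomial, Fin.sum_univ_three, Fin.prod_univ_three,
        Nat.factorial]
      ring
    · norm_num
      ring

theorem exists_poly_of_face_mean_value {r : ℝ} (hr : 0 < r) {f : E3 → ℝ} (hf : Continuous f)
    (h : ∀ (x : E3) (s : ℝ), 0 < s →
      f x = (∫ y in faceSet r, f (x + s • y) ∂μH[2]) / (μH[2] (faceSet r)).toReal)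
    {N : ℕ} (hN : ∀ i, X i ^ N ∈ Ideal.span
      {φ | ∃ k, 1 ≤ k ∧ φ = momentPoly ((μH[2] : Measure E3).restrict (faceSet r)) k}) :
    ∃ p, f = (smoothFn.ofPoly p).1 ∧ Ideal.span
      {φ | ∃ k, 1 ≤ k ∧ φ = momentPoly ((μH[2] : Measure E3).restrict (faceSet r)) k} ≤
      smoothFn.annihilator (smoothFn.ofPoly p) := by
  obtain ⟨V, hV, hVol, -⟩ := eval_evenMomentPoly_faceSet hr
  have := isFiniteMeasure_restrict_faceSet hr
  have hK := isCompact_faceSet r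
  have hν := restrict_faceSet_compl r
  have hmean (x : E3) (s : ℝ) (hs : 0 < s) :
      V * f x = ∫ y in faceSet r, f (x + s • y) ∂μH[2] := by
    rw [h x s hs, hVol]
    field_simp
  obtain ⟨p, rfl⟩ := exists_poly_of_mean_value hK hν hf hmean hN
  refine ⟨p, rfl, Ideal.span_le.2 ?_⟩
  rintro _ ⟨k, hk, rfl⟩
  exact smoothFn.momentPoly_mem_annihilator hK hν hmean hk

theorem face_mean_value_of_momentPoly_mem {r : ℝ} (hr : 0 < r) {p : MvPolynomial (Fin 3) ℝ}
    (hm : ∀ k, 1 ≤ k → momentPoly ((μH[2] : Measure E3).restrict (faceSet r)) k ∈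
      smoothFn.annihilator (smoothFn.ofPoly p))
    {N : ℕ} (hN : ∀ i, X i ^ N ∈ smoothFn.annihilator (smoothFn.ofPoly p)) (x : E3) (s : ℝ) :
    (smoothFn.ofPoly p).1 x = (∫ y in faceSet r, (smoothFn.ofPoly p).1 (x + s • y) ∂μH[2]) /
      (μH[2] (faceSet r)).toReal := by
  obtain ⟨V, hV, hVol, -⟩ := eval_evenMomentPoly_faceSet hr
  have := isFiniteMeasure_restrict_faceSet hr
  rw [smoothFn.mean_value_of_momentPoly_mem (isCompact_faceSet r) (restrict_faceSet_compl r) hm hN,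
    Measure.restrict_apply_univ, hVol]
  field_simp

theorem X_pow_mem_of_expand {J : Ideal (MvPolynomial (Fin 3) ℝ)} {i : Fin 3} {n : ℕ}
    (h : (X i ^ n : MvPolynomial (Fin 3) ℝ) ∈ J.comap (expand 2)) : X i ^ (2 * n) ∈ J := by
  simpa [Ideal.mem_comap, ← pow_mul] using h

theorem X_pow_six_mem {J : Ideal (MvPolynomial (Fin 3) ℝ)} (h2 : e2 ∈ J) (h4 : e4 ∈ J)
    (h6 : e6 ∈ J) (i : Fin 3) : X i ^ 6 ∈ J := by
  rw [← expand_s1] at h2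
  rw [← expand_s2] at h4
  rw [← expand_s3] at h6
  exact X_pow_mem_of_expand (X_pow_three_mem (I := J.comap (expand 2)) h2 h4 h6 i)

theorem X_pow_ten_mem {J : Ideal (MvPolynomial (Fin 3) ℝ)} (h2 : e2 ∈ J) (h4 : e4 ^ 2 ∈ J)
    (h6 : e6 ∈ J) (i : Fin 3) : X i ^ 10 ∈ J := by
  rw [← expand_s1] at h2
  rw [← expand_s2, ← map_pow] at h4
  rw [← expand_s3] at h6
  exact X_pow_mem_of_expand (X_pow_five_mem (I := J.comap (expand 2)) h2 h4 h6 i)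

theorem triakisOctahedron_face_harmonics
    (r : ℝ) (hr : 0 < r)
    (r₂ : ℝ) (hr₂pos : 0 < r₂)
    (hr₂root : 4 * r₂ ^ 4 + 8 * r₂ ^ 3 + 6 * r₂ ^ 2 - 18 * r₂ - 81 = 0)
    (hr₂uniq : ∀ y : ℝ, 0 < y →
      4 * y ^ 4 + 8 * y ^ 3 + 6 * y ^ 2 - 18 * y - 81 = 0 → y = r₂)
    (f : E3 → ℝ) (hf : Continuous f) :
    (∀ (x : E3) (s : ℝ), 0 < s →
        f x = (∫ y in faceSet r, f (x + s • y) ∂(μH[2])) / (μH[2] (faceSet r)).toReal) ↔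
      ((r = r₂ → ∃ p : MvPolynomial (Fin 3) ℝ,
          dop e2 p = 0 ∧ dop e6 p = 0 ∧ dop e4 (dop e4 p) = 0 ∧ ∀ x, f x = eval (toFn x) p) ∧
       (r ≠ r₂ → ∃ p : MvPolynomial (Fin 3) ℝ,
          dop e2 p = 0 ∧ dop e4 p = 0 ∧ dop e6 p = 0 ∧ ∀ x, f x = eval (toFn x) p)) := by
  set ν := (μH[2] : Measure E3).restrict (faceSet r) with hνdef
  set J := Ideal.span {φ | ∃ k, 1 ≤ k ∧ φ = momentPoly ν k} with hJdef
  have hJ (k : ℕ) (hk : 1 ≤ k) : momentPoly ν k ∈ J := Ideal.subset_span ⟨k, hk, rfl⟩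
  have hν : IsOctahedral ν := isOctahedral_faceSet hr
  obtain ⟨V, hV, -, h1, h2, h3, h4⟩ := eval_evenMomentPoly_faceSet hr
  rw [← hνdef] at h1 h2 h3 h4
  have hs1 := s1_mem_comap hν hJ (by rw [h1]; positivity)
  have hs3 := s3_mem_comap hν hJ hs1 (by
    rw [h3]
    have : 0 < 16 * r ^ 6 + 32 * r ^ 5 + 24 * r ^ 4 - 18 * r ^ 3 - 54 * r ^ 2 + 243 := by
      have := pow_pos hr 3
      have := pow_pos hr 5
      nlinarith [sq_nonneg (r ^ 2 - 9 / 5), sq_nonneg (r ^ 3 - 1)]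
    exact mul_ne_zero (neg_ne_zero.2 hV.ne') (by positivity))
  have he2 : e2 ∈ J := expand_s1 ▸ hs1
  have he6 : e6 ∈ J := expand_s3 ▸ hs3
  by_cases hrr : r = r₂
  · have hχ : 4 * r ^ 4 + 8 * r ^ 3 + 6 * r ^ 2 - 18 * r - 81 = 0 := by rw [hrr, hr₂root]
    have he4 : e4 ^ 2 ∈ J := by
      have := s2_sq_mem_comap hν hJ hs1 hs3 (by
        rw [h4, hχ, mul_zero, mul_zero, sub_zero, zero_add]
        positivity)
      rwa [Ideal.mem_comap, map_pow, expand_s2] at this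
    simp only [hrr, ne_eq, not_true_eq_false, IsEmpty.forall_iff, and_true, forall_const]
    rw [← hrr]
    constructor
    · intro h
      obtain ⟨p, rfl, hp⟩ := exists_poly_of_face_mean_value hr hf h (X_pow_ten_mem he2 he4 he6)
      refine ⟨p, smoothFn.mem_annihilator_ofPoly.1 (hp he2),
        smoothFn.mem_annihilator_ofPoly.1 (hp he6), ?_, fun x => rfl⟩
      rw [← smoothFn.dop_mul_apply, ← sq]
      exact smoothFn.mem_annihilator_ofPoly.1 (hp he4)
    · rintro ⟨p, hp2, hp6, hp4, hfp⟩ x s -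
      obtain rfl : f = (smoothFn.ofPoly p).1 := funext hfp
      rw [← smoothFn.dop_mul_apply, ← sq] at hp4
      rw [← smoothFn.mem_annihilator_ofPoly] at hp2 hp4 hp6
      exact face_mean_value_of_momentPoly_mem hr (fun k hk =>
        momentPoly_mem_of_e2_e6_e4_sq hν hp2 hp6 hp4 (by rw [h2, hχ]; simp) hk)
        (X_pow_ten_mem hp2 hp4 hp6) x s
  · have hχ : 4 * r ^ 4 + 8 * r ^ 3 + 6 * r ^ 2 - 18 * r - 81 ≠ 0 :=
      fun h => hrr (hr₂uniq r hr h)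
    have he4 : e4 ∈ J := expand_s2 ▸ s2_mem_comap hν hJ hs1 (by
      rw [h2]
      exact mul_ne_zero (neg_ne_zero.2 hV.ne') (div_ne_zero hχ (by norm_num)))
    simp only [hrr, ne_eq, not_false_eq_true, IsEmpty.forall_iff, true_and, forall_const]
    constructor
    · intro h
      obtain ⟨p, rfl, hp⟩ := exists_poly_of_face_mean_value hr hf h (X_pow_six_mem he2 he4 he6)
      exact ⟨p, smoothFn.mem_annihilator_ofPoly.1 (hp he2),
        smoothFn.mem_annihilator_ofPoly.1 (hp he4), smoothFn.mem_annihilator_ofPoly.1 (hp he6),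
        fun x => rfl⟩
    · rintro ⟨p, hp2, hp4, hp6, hfp⟩ x s -
      obtain rfl : f = (smoothFn.ofPoly p).1 := funext hfp
      rw [← smoothFn.mem_annihilator_ofPoly] at hp2 hp4 hp6
      exact face_mean_value_of_momentPoly_mem hr (fun k hk =>
        momentPoly_mem_of_e2_e4_e6 hν hp2 hp4 hp6 hk) (X_pow_six_mem hp2 hp4 hp6) x s
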